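/- arXiv:2510.16385 — 2 statements merged into one kernel-verified Lean document; each statement's English description precedes it below -/
import Mathlib

section
/- Let G=(V,E) be a finite simple undirected graph with preferences as described, assume P≠∅, let x∈P, and let σ be a strongly stable matching in G. Let v ∈ Q' and let e={v,w} be an edge in B_x(v). Then w ∈ P'. -/
/-!
Common setup: a finite simple undirected graph `G = (V, E)` where edges are
elements of `Sym2 V`, together with, for each vertex `v`, a complete and
transitive preference relation `pref v` on `E(v) ∪ {∅}` (the unmatched
option `∅` is encoded as `none : Option (Sym2 V)`), where every incident
edge is strictly preferred to `∅`.
-/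

/-- A roommates instance: a finite simple graph with preferences. -/
structure RSetup (V : Type*) [Fintype V] [DecidableEq V] where
  /-- the edge set -/
  E : Finset (Sym2 V)
  /-- the graph is simple: no loops -/
  not_diag : ∀ e ∈ E, ¬ e.IsDiag
  /-- the preference relation `≿ᵥ` of each vertex, on `E(v) ∪ {∅}` -/
  pref : V → Option (Sym2 V) → Option (Sym2 V) → Prop
  /-- completeness of `≿ᵥ` on `E(v) ∪ {∅}` -/
  pref_total : ∀ v : V, ∀ a b : Option (Sym2 V),
    (∀ e, a = some e → e ∈ E ∧ v ∈ e) → (∀ e, b = some e → e ∈ E ∧ v ∈ e) →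
    pref v a b ∨ pref v b a
  /-- transitivity of `≿ᵥ` on `E(v) ∪ {∅}` -/
  pref_trans : ∀ v : V, ∀ a b c : Option (Sym2 V),
    (∀ e, a = some e → e ∈ E ∧ v ∈ e) → (∀ e, b = some e → e ∈ E ∧ v ∈ e) →
    (∀ e, c = some e → e ∈ E ∧ v ∈ e) →
    pref v a b → pref v b c → pref v a c
  /-- every incident edge is strictly preferred to being unmatched -/
  pref_none : ∀ v : V, ∀ e ∈ E, v ∈ e →
    pref v (some e) none ∧ ¬ pref v none (some e)

namespace RSetup

variable {V : Type*} [Fintype V] [DecidableEq V] (S : RSetup V)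

/-- `a ≻ᵥ b` : strict preference. -/
def SPref (v : V) (a b : Option (Sym2 V)) : Prop :=
  S.pref v a b ∧ ¬ S.pref v b a

/-- `a ∼ᵥ b` : indifference. -/
def IPref (v : V) (a b : Option (Sym2 V)) : Prop :=
  S.pref v a b ∧ S.pref v b a

/-- `F(v)` : the set of edges in `F` incident to `v`. -/
def inc (F : Finset (Sym2 V)) (v : V) : Finset (Sym2 V) :=
  F.filter (fun e => v ∈ e)

/-- a matching in `G` -/
def IsMatching (μ : Finset (Sym2 V)) : Prop :=
  μ ⊆ S.E ∧ ∀ v : V, (inc μ v).card ≤ 1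

/-- `μ(v)` : the edge of `μ` incident to `v` (or `none`). -/
noncomputable def matchOf (μ : Finset (Sym2 V)) (v : V) : Option (Sym2 V) :=
  (inc μ v).toList.head?

/-- `e` blocks the matching `μ`. -/
def Blocks (μ : Finset (Sym2 V)) (e : Sym2 V) : Prop :=
  e ∈ S.E ∧ e ∉ μ ∧ (∀ v ∈ e, S.pref v (some e) (matchOf μ v)) ∧
    (∃ v ∈ e, S.SPref v (some e) (matchOf μ v))

/-- a strongly stable matching in `G` -/
def StronglyStable (μ : Finset (Sym2 V)) : Prop :=
  S.IsMatching μ ∧ ∀ e : Sym2 V, ¬ S.Blocks μ e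

/-- `x(W) = ∑_{e ∈ W} x(e)` -/
def xS (x : Sym2 V → ℝ) (W : Finset (Sym2 V)) : ℝ := ∑ e ∈ W, x e

/-- `x ∈ ℝ₊^E`, encoded as a nonnegative function on `Sym2 V` vanishing
outside `E`. -/
def IsVec (x : Sym2 V → ℝ) : Prop :=
  (∀ e, 0 ≤ x e) ∧ ∀ e ∉ S.E, x e = 0

open Classical in
/-- `E[∼ᵥ e] = {f ∈ E(v) : f ∼ᵥ e}` -/
noncomputable def simSet (v : V) (e : Sym2 V) : Finset (Sym2 V) :=
  (inc S.E v).filter (fun f => S.IPref v (some f) (some e))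

open Classical in
/-- `E[≻ᵥ e] = {f ∈ E(v) : f ≻ᵥ e}` -/
noncomputable def succSet (v : V) (e : Sym2 V) : Finset (Sym2 V) :=
  (inc S.E v).filter (fun f => S.SPref v (some f) (some e))

open Classical in
/-- `E⟨X⟩ = {e ∈ E : e ⊆ X}` -/
noncomputable def esub (X : Finset V) : Finset (Sym2 V) :=
  S.E.filter (fun e => ∀ u ∈ e, u ∈ X)

/-- constraint (1): `x(E(v)) ≤ 1` for every vertex `v` -/
def C1 (x : Sym2 V → ℝ) : Prop := ∀ v : V, xS x (inc S.E v) ≤ 1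

/-- constraint (2): `x(E[∼ᵥ e]) + ∑_{w ∈ e} x(E[≻_w e]) ≥ 1`
for every edge `e ∈ E` and `v ∈ e` -/
def C2 (x : Sym2 V → ℝ) : Prop := ∀ v w : V, s(v, w) ∈ S.E →
  xS x (S.simSet v s(v, w)) +
    (xS x (S.succSet v s(v, w)) + xS x (S.succSet w s(v, w))) ≥ 1

/-- constraint (3): `x(E⟨X⟩) ≤ ⌊|X|/2⌋` for every odd `X ⊆ V` -/
def C3 (x : Sym2 V → ℝ) : Prop := ∀ X : Finset V, Odd X.card →
  xS x (S.esub X) ≤ ((X.card / 2 : ℕ) : ℝ)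

/-- membership in the polytope `P` -/
def memP (x : Sym2 V → ℝ) : Prop := S.IsVec x ∧ S.C1 x ∧ S.C2 x ∧ S.C3 x

/-- the characteristic vector `χ_μ` of a set of edges -/
def chi (μ : Finset (Sym2 V)) : Sym2 V → ℝ := fun e => if e ∈ μ then 1 else 0

open Classical in
/-- `E_x = {e ∈ E : x(e) > 0}` -/
noncomputable def supp (x : Sym2 V → ℝ) : Finset (Sym2 V) :=
  S.E.filter (fun e => 0 < x e)

/-- `V₁` : the set of vertices `v` with `x(E(v)) > 0` for some `x ∈ P` -/
def V1 : Set V := {v : V | ∃ x : Sym2 V → ℝ, S.memP x ∧ 0 < xS x (inc S.E v)}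

open Classical in
/-- `B_x(v)` : the best edges in `E_x(v)` for `v` -/
noncomputable def Bset (x : Sym2 V → ℝ) (v : V) : Finset (Sym2 V) :=
  (inc (S.supp x) v).filter
    (fun e => ∀ f ∈ inc (S.supp x) v, S.pref v (some e) (some f))

open Classical in
/-- `W_x(v)` : the worst edges in `E_x(v)` for `v` -/
noncomputable def Wset (x : Sym2 V → ℝ) (v : V) : Finset (Sym2 V) :=
  (inc (S.supp x) v).filter
    (fun e => ∀ f ∈ inc (S.supp x) v, S.pref v (some f) (some e))

/-- a nonempty `F ⊆ E(v)` is flat if `v` is indifferent among its members -/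
def Flat (v : V) (F : Finset (Sym2 V)) : Prop :=
  F.Nonempty ∧ ∀ e ∈ F, ∀ f ∈ F, S.IPref v (some e) (some f)

open Classical in
/-- `T_x` : edges `e ∈ E⟨V₁⟩` such that, for each `v ∈ e`, either
`e ∈ B_x(v) ∪ W_x(v)` or `B_x(v) ≻ᵥ e ≻ᵥ W_x(v)`. -/
noncomputable def Tset (x : Sym2 V → ℝ) : Finset (Sym2 V) :=
  (S.E.filter (fun e => ∀ u ∈ e, u ∈ S.V1)).filter (fun e => ∀ v ∈ e,
    (e ∈ S.Bset x v ∪ S.Wset x v) ∨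
      ((∀ f ∈ S.Bset x v, S.SPref v (some f) (some e)) ∧
        (∀ f ∈ S.Wset x v, S.SPref v (some e) (some f))))

/-- membership in `P(F) = {x ∈ P : x(e) = 0 for all e ∈ E \ F}` -/
def memPF (F : Finset (Sym2 V)) (x : Sym2 V → ℝ) : Prop :=
  S.memP x ∧ ∀ e ∈ S.E, e ∉ F → x e = 0

open Classical in
/-- `E⁺ = {e ∈ E : e ∈ E_z for some z ∈ P}` -/
noncomputable def Eplus : Finset (Sym2 V) :=
  S.E.filter (fun e => ∃ z : Sym2 V → ℝ, S.memP z ∧ 0 < z e)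

open Classical in
/-- `P'` : given `x ∈ P` and a strongly stable matching `σ`, the set of
vertices `v ∈ V₁` with `W_x(v) ≻ᵥ σ(v)`, or with
`B_x(v) ≻ᵥ W_x(v)` and `W_x(v) ∼ᵥ σ(v)`. -/
def Pset (x : Sym2 V → ℝ) (σ : Finset (Sym2 V)) : Set V :=
  {v : V | v ∈ S.V1 ∧
    ((∀ f ∈ S.Wset x v, S.SPref v (some f) (matchOf σ v)) ∨
      ((∀ f ∈ S.Bset x v, ∀ g ∈ S.Wset x v, S.SPref v (some f) (some g)) ∧
        (∀ f ∈ S.Wset x v, S.IPref v (some f) (matchOf σ v))))}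

/-- `Q'` : given `x ∈ P` and a strongly stable matching `σ`, the set of
vertices `v ∈ V₁` with `σ(v) ≻ᵥ B_x(v)`, or with
`B_x(v) ≻ᵥ W_x(v)` and `B_x(v) ∼ᵥ σ(v)`. -/
def Qset (x : Sym2 V → ℝ) (σ : Finset (Sym2 V)) : Set V :=
  {v : V | v ∈ S.V1 ∧
    ((∀ f ∈ S.Bset x v, S.SPref v (matchOf σ v) (some f)) ∨
      ((∀ f ∈ S.Bset x v, ∀ g ∈ S.Wset x v, S.SPref v (some f) (some g)) ∧
        (∀ f ∈ S.Bset x v, S.IPref v (some f) (matchOf σ v))))}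

/-- `R'` : given `x ∈ P` and a strongly stable matching `σ`, the set of
vertices `v ∈ V₁` such that `E_x(v)` is flat and `E_x(v) ∼ᵥ σ(v)`. -/
def Rset (x : Sym2 V → ℝ) (σ : Finset (Sym2 V)) : Set V :=
  {v : V | v ∈ S.V1 ∧ S.Flat v (inc (S.supp x) v) ∧
    ∀ f ∈ inc (S.supp x) v, S.IPref v (some f) (matchOf σ v)}

end RSetup
namespace RSetup

theorem mem_inc {V : Type*} [DecidableEq V] {F : Finset (Sym2 V)} {v : V} {e : Sym2 V} :
    e ∈ inc F v ↔ e ∈ F ∧ v ∈ e := by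
  simp [inc]

variable {V : Type*} [Fintype V] [DecidableEq V] (S : RSetup V)

/-- `a` is an available option for `v`: unmatched, or an edge incident to `v`. -/
def Valid (v : V) (a : Option (Sym2 V)) : Prop := ∀ e, a = some e → e ∈ S.E ∧ v ∈ e

variable {S}

theorem valid_some {v : V} {e : Sym2 V} (he : e ∈ S.E) (hv : v ∈ e) : S.Valid v (some e) := by
  rintro f ⟨⟩
  exact ⟨he, hv⟩

theorem valid_none {v : V} : S.Valid v none := by
  rintro f ⟨⟩

theorem mem_supp {x : Sym2 V → ℝ} {e : Sym2 V} : e ∈ S.supp x ↔ e ∈ S.E ∧ 0 < x e := by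
  simp [supp]

theorem IsMatching.matchOf_cases {σ : Finset (Sym2 V)} (hσ : S.IsMatching σ) (v : V) :
    (inc σ v = ∅ ∧ matchOf σ v = none) ∨ ∃ f, inc σ v = {f} ∧ matchOf σ v = some f := by
  rcases Nat.le_one_iff_eq_zero_or_eq_one.1 (hσ.2 v) with h | h
  · left
    simp [matchOf, Finset.card_eq_zero.1 h]
  · obtain ⟨f, hf⟩ := Finset.card_eq_one.1 h
    exact Or.inr ⟨f, hf, by simp [matchOf, hf]⟩

theorem IsMatching.valid_matchOf {σ : Finset (Sym2 V)} (hσ : S.IsMatching σ) (v : V) :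
    S.Valid v (matchOf σ v) := by
  rcases hσ.matchOf_cases v with ⟨-, h⟩ | ⟨f, hf, h⟩
  · rw [h]; exact valid_none
  · have hm := mem_inc.1 (hf ▸ Finset.mem_singleton_self f : f ∈ inc σ v)
    rw [h]; exact valid_some (hσ.1 hm.1) hm.2

theorem IsMatching.matchOf_eq_some {σ : Finset (Sym2 V)} (hσ : S.IsMatching σ) {v : V}
    {e : Sym2 V} (he : e ∈ σ) (hv : v ∈ e) : matchOf σ v = some e := by
  have hm : e ∈ inc σ v := mem_inc.2 ⟨he, hv⟩
  rcases hσ.matchOf_cases v with ⟨h, -⟩ | ⟨f, hf, h⟩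
  · simp [h] at hm
  · rw [hf, Finset.mem_singleton] at hm
    rw [h, hm]

variable (S)

open Classical in
/-- The score of `a` against `b` at `v`: `1` for a win, `1/2` for a tie, `0` for a loss. -/
noncomputable def score (v : V) (a b : Option (Sym2 V)) : ℝ :=
  if S.SPref v a b then 1 else if S.IPref v a b then 1 / 2 else 0

variable {S}

theorem score_add_score {v : V} {a b : Option (Sym2 V)} (ha : S.Valid v a) (hb : S.Valid v b) :
    S.score v a b + S.score v b a = 1 := by
  have := S.pref_total v a b ha hb
  unfold score SPref IPref
  by_cases h₁ : S.pref v a b <;> by_cases h₂ : S.pref v b a <;> simp_all; norm_num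

theorem score_none {v : V} {e : Sym2 V} (he : e ∈ S.E) (hv : v ∈ e) :
    S.score v none (some e) = 0 := by
  have := S.pref_none v e he hv
  simp [score, SPref, IPref, this]

/-- The end vertices of an edge share out at least one point when a strongly stable matching
plays against that edge. -/
theorem StronglyStable.one_le_score {σ : Finset (Sym2 V)} (hσ : S.StronglyStable σ) {a b : V}
    (he : s(a, b) ∈ S.E) :
    1 ≤ S.score a (matchOf σ a) (some s(a, b)) + S.score b (matchOf σ b) (some s(a, b)) := by
  have va : S.Valid a (some s(a, b)) := valid_some he (Sym2.mem_mk_left a b)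
  have vb : S.Valid b (some s(a, b)) := valid_some he (Sym2.mem_mk_right a b)
  by_cases hm : s(a, b) ∈ σ
  · rw [hσ.1.matchOf_eq_some hm (Sym2.mem_mk_left a b),
      hσ.1.matchOf_eq_some hm (Sym2.mem_mk_right a b)]
    linarith [score_add_score va va, score_add_score vb vb]
  · have hb := hσ.2 s(a, b)
    have ta := S.pref_total a _ _ va (hσ.1.valid_matchOf a)
    have tb := S.pref_total b _ _ vb (hσ.1.valid_matchOf b)
    simp only [Blocks, he, hm, Sym2.mem_iff, forall_eq_or_imp, forall_eq, exists_eq_or_imp,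
      exists_eq_left, SPref, not_false_eq_true, true_and] at hb
    unfold score SPref IPref
    by_cases h₁ : S.pref a (some s(a, b)) (matchOf σ a) <;>
    by_cases h₂ : S.pref a (matchOf σ a) (some s(a, b)) <;>
    by_cases h₃ : S.pref b (some s(a, b)) (matchOf σ b) <;>
    by_cases h₄ : S.pref b (matchOf σ b) (some s(a, b)) <;>
    simp_all; norm_num

/-- The expected score of `x` against the edge `f` at `v`. -/
theorem sum_mul_score (x : Sym2 V → ℝ) (v : V) (f : Sym2 V) :
    ∑ e ∈ inc S.E v, x e * S.score v (some e) (some f) =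
      xS x (S.succSet v f) + xS x (S.simSet v f) / 2 := by
  classical
  unfold xS succSet simSet
  rw [Finset.sum_filter, Finset.sum_filter, Finset.sum_div, ← Finset.sum_add_distrib]
  refine Finset.sum_congr rfl fun e _ => ?_
  unfold score SPref IPref
  by_cases h₁ : S.pref v (some e) (some f) <;> by_cases h₂ : S.pref v (some f) (some e) <;>
    simp [h₁, h₂]; ring

theorem C2.one_le_sum_mul_score {x : Sym2 V → ℝ} (hx : S.C2 x) {a b : V} (he : s(a, b) ∈ S.E) :
    1 ≤ ∑ e ∈ inc S.E a, x e * S.score a (some e) (some s(a, b)) +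
      ∑ e ∈ inc S.E b, x e * S.score b (some e) (some s(a, b)) := by
  have h₁ := hx a b he
  have h₂ := hx b a (Sym2.eq_swap ▸ he)
  rw [Sym2.eq_swap (a := b)] at h₂
  rw [sum_mul_score, sum_mul_score]
  linarith

theorem sum_sum_inc {F : Finset (Sym2 V)} (g : V → Sym2 V → ℝ) :
    ∑ v, ∑ e ∈ inc F v, g v e = ∑ e ∈ F, ∑ v with v ∈ e, g v e := by
  simp only [inc, Finset.sum_filter]
  exact Finset.sum_comm

theorem sum_mem_edge {a b : V} (hab : s(a, b) ∈ S.E) (g : V → ℝ) :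
    ∑ v with v ∈ s(a, b), g v = g a + g b := by
  have hne : a ≠ b := fun h => S.not_diag _ hab (Sym2.mk_isDiag_iff.2 h)
  have : Finset.univ.filter (fun v => v ∈ s(a, b)) = {a, b} := by
    ext; simp
  rw [this, Finset.sum_pair hne]

theorem sum_sum_inc_const {F : Finset (Sym2 V)} (hF : F ⊆ S.E) (g : Sym2 V → ℝ) :
    ∑ v, ∑ e ∈ inc F v, g e = 2 * ∑ e ∈ F, g e := by
  rw [sum_sum_inc fun _ e => g e, Finset.mul_sum]
  refine Finset.sum_congr rfl fun e he => ?_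
  induction e with
  | h a b => rw [sum_mem_edge (hF he)]; ring

/-- On the support of a point of the polytope, the scores of a strongly stable matching against
an edge add up to exactly one. -/
theorem score_add_score_eq_one_of_pos {x : Sym2 V → ℝ} (hx : S.memP x) {σ : Finset (Sym2 V)}
    (hσ : S.StronglyStable σ) {a b : V} (he : s(a, b) ∈ S.E) (hpos : 0 < x s(a, b)) :
    S.score a (matchOf σ a) (some s(a, b)) + S.score b (matchOf σ b) (some s(a, b)) = 1 := by
  obtain ⟨⟨hnn, -⟩, hC1, hC2, -⟩ := hx
  have hle : ∀ e ∈ S.E, x e ≤ ∑ v with v ∈ e, x e * S.score v (matchOf σ v) (some e) := by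
    intro e he
    induction e with
    | h a b =>
      rw [sum_mem_edge he, ← mul_add]
      exact le_mul_of_one_le_right (hnn _) (hσ.one_le_score he)
  have hB : (σ.card : ℝ) ≤ ∑ v, ∑ f ∈ inc σ v, ∑ e ∈ inc S.E v,
      x e * S.score v (some e) (some f) := by
    rw [sum_sum_inc, Finset.cast_card]
    refine Finset.sum_le_sum fun f hf => ?_
    induction f with
    | h a b =>
      rw [sum_mem_edge (hσ.1.1 hf)]
      exact hC2.one_le_sum_mul_score (hσ.1.1 hf)
  have hAB : ∑ v, ∑ e ∈ inc S.E v, x e * S.score v (matchOf σ v) (some e) +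
      ∑ v, ∑ f ∈ inc σ v, ∑ e ∈ inc S.E v, x e * S.score v (some e) (some f) ≤
      ∑ v, (∑ e ∈ inc S.E v, x e / 2 + ∑ f ∈ inc σ v, (1 / 2 : ℝ)) := by
    rw [← Finset.sum_add_distrib]
    refine Finset.sum_le_sum fun v _ => ?_
    have h1 : ∑ e ∈ inc S.E v, x e ≤ 1 := hC1 v
    rw [← Finset.sum_div]
    rcases hσ.1.matchOf_cases v with ⟨h, hm⟩ | ⟨f, hf, hm⟩
    · rw [h, hm, Finset.sum_eq_zero fun e he => by
        rw [score_none (mem_inc.1 he).1 (mem_inc.1 he).2, mul_zero]]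
      have := Finset.sum_nonneg fun e (_ : e ∈ inc S.E v) => hnn e
      simp only [Finset.sum_empty]
      linarith
    · rw [hf, hm, Finset.sum_singleton, Finset.sum_singleton, ← Finset.sum_add_distrib]
      rw [Finset.sum_congr rfl fun e he => by
        rw [← mul_add, score_add_score (hm ▸ hσ.1.valid_matchOf v)
          (valid_some (mem_inc.1 he).1 (mem_inc.1 he).2), mul_one]]
      linarith
  rw [Finset.sum_add_distrib, sum_sum_inc_const subset_rfl, sum_sum_inc_const hσ.1.1,
    sum_sum_inc, ← Finset.sum_div, Finset.sum_const, nsmul_eq_mul] at hAB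
  have heq := (Finset.sum_eq_sum_iff_of_le hle).1
    (le_antisymm (Finset.sum_le_sum hle) (by linarith)) _ he
  rw [sum_mem_edge he, ← mul_add] at heq
  exact (mul_left_cancel₀ hpos.ne' (by linarith))

theorem xS_succSet_of_mem_Bset {x : Sym2 V → ℝ} (hx : S.IsVec x) {v : V} {e : Sym2 V}
    (he : e ∈ S.Bset x v) : xS x (S.succSet v e) = 0 := by
  simp only [Bset, Finset.mem_filter, mem_inc, mem_supp] at he
  refine Finset.sum_eq_zero fun f hf => ?_
  simp only [succSet, Finset.mem_filter, mem_inc] at hf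
  by_contra hne
  exact hf.2.2 (he.2 f ⟨⟨hf.1.1, lt_of_le_of_ne (hx.1 f) (Ne.symm hne)⟩, hf.1.2⟩)

/-- A best edge of the support at one end vertex is a worst one at the other end vertex. -/
theorem mem_Wset_of_mem_Bset {x : Sym2 V → ℝ} (hx : S.memP x) {v w : V}
    (he : s(v, w) ∈ S.Bset x v) : s(v, w) ∈ S.Wset x w := by
  classical
  have h0 := xS_succSet_of_mem_Bset hx.1 he
  obtain ⟨⟨hnn, -⟩, hC1, hC2, -⟩ := hx
  simp only [Bset, Finset.mem_filter, mem_inc, mem_supp] at he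
  obtain ⟨⟨⟨heE, hpos⟩, -⟩, -⟩ := he
  simp only [Wset, Finset.mem_filter, mem_inc, mem_supp]
  refine ⟨⟨⟨heE, hpos⟩, Sym2.mem_mk_right v w⟩, ?_⟩
  rintro f ⟨⟨hfE, hfpos⟩, hwf⟩
  by_contra hf
  have h := hC2 w v (Sym2.eq_swap ▸ heE)
  rw [Sym2.eq_swap (a := w), h0, add_zero] at h
  have hdisj : Disjoint (S.simSet w s(v, w)) (S.succSet w s(v, w)) := by
    refine Finset.disjoint_filter.2 fun g _ h₁ h₂ => h₂.2 h₁.2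
  have hlt : xS x (S.simSet w s(v, w) ∪ S.succSet w s(v, w)) < xS x (inc S.E w) := by
    refine Finset.sum_lt_sum_of_subset
      (Finset.union_subset (Finset.filter_subset _ _) (Finset.filter_subset _ _))
      (mem_inc.2 ⟨hfE, hwf⟩) ?_ hfpos fun g _ _ => hnn g
    simp only [simSet, succSet, Finset.mem_union, Finset.mem_filter]
    rintro (h | h)
    exacts [hf h.2.1, hf h.2.1]
  have hunion : xS x (S.simSet w s(v, w) ∪ S.succSet w s(v, w)) =
      xS x (S.simSet w s(v, w)) + xS x (S.succSet w s(v, w)) := Finset.sum_union hdisj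
  linarith [hC1 w]

/-- If a best edge at `v` is not also a worst edge at `v`, then its other end vertex has a strictly
better edge in the support. -/
theorem exists_sPref_of_mem_Bset {x : Sym2 V → ℝ} (hx : S.memP x) {v w : V}
    (he : s(v, w) ∈ S.Bset x v) (hW : s(v, w) ∉ S.Wset x v) :
    ∃ f ∈ inc (S.supp x) w, S.SPref w (some f) (some s(v, w)) := by
  classical
  have h0 := xS_succSet_of_mem_Bset hx.1 he
  obtain ⟨⟨hnn, -⟩, hC1, hC2, -⟩ := hx
  have hmem := (Finset.mem_filter.1 he).1
  have heE := (mem_supp.1 (mem_inc.1 hmem).1).1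
  obtain ⟨g, hg, hgp⟩ : ∃ g ∈ inc (S.supp x) v, ¬ S.pref v (some g) (some s(v, w)) := by
    by_contra! h
    exact hW (Finset.mem_filter.2 ⟨hmem, h⟩)
  obtain ⟨hgs, hvg⟩ := mem_inc.1 hg
  obtain ⟨hgE, hgpos⟩ := mem_supp.1 hgs
  have hlt : xS x (S.simSet v s(v, w)) < xS x (inc S.E v) := by
    refine Finset.sum_lt_sum_of_subset (Finset.filter_subset _ _)
      (mem_inc.2 ⟨hgE, hvg⟩) ?_ hgpos fun g _ _ => hnn g
    exact fun h => hgp (Finset.mem_filter.1 h).2.1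
  have hpos : 0 < xS x (S.succSet w s(v, w)) := by
    linarith [hC1 v, hC2 v w heE]
  obtain ⟨f, hf, hfpos⟩ : ∃ f ∈ S.succSet w s(v, w), 0 < x f := by
    by_contra! h
    exact hpos.not_ge (Finset.sum_nonpos h)
  obtain ⟨hf, hfp⟩ := Finset.mem_filter.1 hf
  exact ⟨f, mem_inc.2 ⟨mem_supp.2 ⟨(mem_inc.1 hf).1, hfpos⟩, (mem_inc.1 hf).2⟩, hfp⟩

theorem valid_of_mem_inc_supp {x : Sym2 V → ℝ} {v : V} {e : Sym2 V}
    (he : e ∈ inc (S.supp x) v) : S.Valid v (some e) :=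
  valid_some (mem_supp.1 (mem_inc.1 he).1).1 (mem_inc.1 he).2

theorem SPref.trans_pref {v : V} {a b c : Option (Sym2 V)} (ha : S.Valid v a) (hb : S.Valid v b)
    (hc : S.Valid v c) (hab : S.SPref v a b) (hbc : S.pref v b c) : S.SPref v a c :=
  ⟨S.pref_trans v a b c ha hb hc hab.1 hbc, fun h => hab.2 (S.pref_trans v b c a hb hc ha hbc h)⟩

theorem SPref.pref_trans {v : V} {a b c : Option (Sym2 V)} (ha : S.Valid v a) (hb : S.Valid v b)
    (hc : S.Valid v c) (hab : S.pref v a b) (hbc : S.SPref v b c) : S.SPref v a c :=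
  ⟨S.pref_trans v a b c ha hb hc hab hbc.1, fun h => hbc.2 (S.pref_trans v c a b hc ha hb h hab)⟩

theorem SPref.score_eq {v : V} {a b : Option (Sym2 V)} (h : S.SPref v a b) :
    S.score v a b = 1 := by
  simp [score, h]

theorem IPref.score_eq {v : V} {a b : Option (Sym2 V)} (h : S.IPref v a b) :
    S.score v a b = 1 / 2 := by
  simp [score, SPref, h, h.1, h.2]

theorem sPref_of_score_eq_zero {v : V} {a b : Option (Sym2 V)} (ha : S.Valid v a)
    (hb : S.Valid v b) (h : S.score v a b = 0) : S.SPref v b a := by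
  have := S.pref_total v a b ha hb
  unfold score at h
  split_ifs at h with h₁ h₂
  · norm_num at h
  · norm_num at h
  · unfold SPref IPref at *
    tauto

theorem iPref_of_score_eq_half {v : V} {a b : Option (Sym2 V)}
    (h : S.score v a b = 1 / 2) : S.IPref v a b := by
  unfold score at h
  split_ifs at h with h₁ h₂
  · norm_num at h
  · exact h₂
  · norm_num at h

end RSetup

open RSetup in
/-- Lemma 13: for `x ∈ P`, a strongly stable matching `σ`,
`v ∈ Q'`, and an edge `e = {v, w} ∈ B_x(v)`, we have `w ∈ P'`. -/
theorem mem_Pset_of_adj_Qset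
    {V : Type*} [Fintype V] [DecidableEq V] (S : RSetup V)
    (hP : ∃ y : Sym2 V → ℝ, S.memP y)
    (x : Sym2 V → ℝ) (hx : S.memP x)
    (σ : Finset (Sym2 V)) (hσ : S.StronglyStable σ)
    (v w : V) (hv : v ∈ S.Qset x σ)
    (he : s(v, w) ∈ S.Bset x v) :
    w ∈ S.Pset x σ := by
  classical
  have hBW := mem_Wset_of_mem_Bset hx he
  have hev := (Finset.mem_filter.1 he).1
  obtain ⟨hew, hworst⟩ := Finset.mem_filter.1 hBW
  obtain ⟨heE, hpos⟩ := mem_supp.1 (mem_inc.1 hev).1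
  have hsum := score_add_score_eq_one_of_pos hx hσ heE hpos
  have vew := valid_of_mem_inc_supp hew
  have vσ := hσ.1.valid_matchOf w
  refine ⟨⟨x, hx, Finset.sum_pos' (fun e _ => hx.1.1 e)
    ⟨_, mem_inc.2 ⟨heE, Sym2.mem_mk_right v w⟩, hpos⟩⟩, ?_⟩
  rcases hv.2 with h | ⟨h, h'⟩
  · left
    intro f hf
    have hf' := (Finset.mem_filter.1 hf).1
    rw [(h _ he).score_eq] at hsum
    exact SPref.pref_trans (valid_of_mem_inc_supp hf') vew vσ (hworst f hf')
      (sPref_of_score_eq_zero vσ vew (by linarith))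
  · right
    have hσv : S.IPref v (matchOf σ v) (some s(v, w)) := ⟨(h' _ he).2, (h' _ he).1⟩
    rw [hσv.score_eq] at hsum
    have hσw : S.IPref w (matchOf σ w) (some s(v, w)) := iPref_of_score_eq_half (by linarith)
    obtain ⟨k, hk, hke⟩ := exists_sPref_of_mem_Bset hx he fun hW => (h _ he _ hW).2 (h _ he _ hW).1
    have vk := valid_of_mem_inc_supp hk
    refine ⟨fun f hf g hg => ?_, fun f hf => ?_⟩
    · obtain ⟨hf', hfbest⟩ := Finset.mem_filter.1 hf
      obtain ⟨hg', hgworst⟩ := Finset.mem_filter.1 hg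
      have vf := valid_of_mem_inc_supp hf'
      exact (SPref.pref_trans vf vk vew (hfbest k hk) hke).trans_pref vf vew
        (valid_of_mem_inc_supp hg') (hgworst _ hew)
    · obtain ⟨hf', hfworst⟩ := Finset.mem_filter.1 hf
      have vf := valid_of_mem_inc_supp hf'
      exact ⟨S.pref_trans w _ _ _ vf vew vσ (hworst f hf') hσw.2,
        S.pref_trans w _ _ _ vσ vew vf hσw.1 (hfworst _ hew)⟩
end

section
/- Let G=(V,E) be a finite simple undirected graph with preferences as described, and assume P≠∅. Suppose there exist x∈P and an edge g∈E such that every element y of P(T_x) satisfies 0 < y(g) < 1. Then there is no strongly stable matching in G. -/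
section Core
variable {V : Type*} [Fintype V]

/-- Total weight on partners that `v` weakly prefers to `w`. -/
def weakUp (rk : V → V → ℕ) (y : V → V → ℝ) (v w : V) : ℝ :=
  ∑ u, if rk v w ≤ rk v u then y v u else 0

/-- Total weight on partners that `v` strictly prefers to `w`. -/
def strictUp (rk : V → V → ℕ) (y : V → V → ℝ) (v w : V) : ℝ :=
  ∑ u, if rk v w < rk v u then y v u else 0

/-- Fractional strongly stable matchings, written as symmetric matrices; `rk v u` ranks the
partner `u` in the preferences of `v` (larger is better). -/
structure FracStable (A : V → V → Prop) (rk : V → V → ℕ) (y : V → V → ℝ) : Prop where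
  nonneg : ∀ v w, 0 ≤ y v w
  symm : ∀ v w, y v w = y w v
  supp : ∀ v w, ¬ A v w → y v w = 0
  row_le : ∀ v, ∑ w, y v w ≤ 1
  cover : ∀ v w, A v w → 1 ≤ weakUp rk y v w + strictUp rk y w v
  odd : ∀ C : Finset V, Odd C.card → ∑ a ∈ C, ∑ b ∈ C, y a b ≤ C.card - 1

namespace FracStable
variable {A : V → V → Prop} {rk : V → V → ℕ} {x y : V → V → ℝ}

theorem sum_mul_weakUp_add_strictUp (rk : V → V → ℕ) (y : V → V → ℝ) (v : V) :
    ∑ w, y v w * (weakUp rk y v w + strictUp rk y v w) = (∑ w, y v w) ^ 2 := by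
  have h1 : ∑ w, y v w * strictUp rk y v w
      = ∑ w, ∑ u, (if rk v u < rk v w then y v w * y v u else 0) := by
    rw [Finset.sum_comm]
    refine Finset.sum_congr rfl fun w _ => ?_
    rw [strictUp, Finset.mul_sum]
    refine Finset.sum_congr rfl fun u _ => ?_
    split_ifs <;> ring
  have h2 : ∑ w, y v w * weakUp rk y v w
      = ∑ w, ∑ u, (if rk v w ≤ rk v u then y v w * y v u else 0) := by
    refine Finset.sum_congr rfl fun w _ => ?_
    rw [weakUp, Finset.mul_sum]
    refine Finset.sum_congr rfl fun u _ => ?_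
    split_ifs <;> ring
  simp only [mul_add, Finset.sum_add_distrib]
  rw [h1, h2, ← Finset.sum_add_distrib, sq, Finset.sum_mul_sum]
  refine Finset.sum_congr rfl fun w _ => ?_
  rw [← Finset.sum_add_distrib]
  refine Finset.sum_congr rfl fun u _ => ?_
  split_ifs <;> first | omega | ring

theorem row_nonneg (hy : FracStable A rk y) (v : V) : 0 ≤ ∑ w, y v w :=
  Finset.sum_nonneg fun w _ => hy.nonneg v w

theorem slack (hy : FracStable A rk y) :
    (∀ v, (∑ w, y v w) ^ 2 = ∑ w, y v w) ∧
      ∀ v w, y v w * (weakUp rk y v w + strictUp rk y w v - 1) = 0 := by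
  have h1 : ∑ v, ∑ w, y v w * strictUp rk y w v = ∑ v, ∑ w, y v w * strictUp rk y v w := by
    rw [Finset.sum_comm]
    refine Finset.sum_congr rfl fun v _ => Finset.sum_congr rfl fun w _ => ?_
    rw [hy.symm]
  have h2 : ∑ v, ∑ w, y v w * (weakUp rk y v w + strictUp rk y w v - 1)
      + ∑ v, (∑ w, y v w - (∑ w, y v w) ^ 2) = 0 := by
    simp_rw [← sum_mul_weakUp_add_strictUp rk y]
    simp only [mul_add, mul_sub, Finset.sum_add_distrib, Finset.sum_sub_distrib, h1, mul_one]
    ring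
  have h3 : ∀ v w, 0 ≤ y v w * (weakUp rk y v w + strictUp rk y w v - 1) := by
    intro v w
    by_cases hA : A v w
    · exact mul_nonneg (hy.nonneg v w) (by linarith [hy.cover v w hA])
    · rw [hy.supp v w hA, zero_mul]
  have h4 : ∀ v, 0 ≤ ∑ w, y v w - (∑ w, y v w) ^ 2 := by
    intro v
    nlinarith [hy.row_le v, hy.row_nonneg v]
  have h5 : ∀ v, 0 ≤ ∑ w, y v w * (weakUp rk y v w + strictUp rk y w v - 1) :=
    fun v => Finset.sum_nonneg fun w _ => h3 v w
  have h6 := Finset.sum_nonneg fun v (_ : v ∈ Finset.univ) => h5 v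
  have h7 := Finset.sum_nonneg fun v (_ : v ∈ Finset.univ) => h4 v
  constructor
  · intro v
    have := (Finset.sum_eq_zero_iff_of_nonneg fun v _ => h4 v).1 (by linarith) v
      (Finset.mem_univ v)
    linarith
  · intro v w
    have := (Finset.sum_eq_zero_iff_of_nonneg fun v _ => h5 v).1 (by linarith) v
      (Finset.mem_univ v)
    exact (Finset.sum_eq_zero_iff_of_nonneg fun w _ => h3 v w).1 this w (Finset.mem_univ w)

theorem midpoint_weakUp (rk : V → V → ℕ) (x y : V → V → ℝ) (v w : V) :
    weakUp rk (fun a b => (x a b + y a b) / 2) v w = (weakUp rk x v w + weakUp rk y v w) / 2 := by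
  simp only [weakUp, ← Finset.sum_add_distrib, Finset.sum_div]
  refine Finset.sum_congr rfl fun u _ => ?_
  split_ifs <;> ring

theorem midpoint_strictUp (rk : V → V → ℕ) (x y : V → V → ℝ) (v w : V) :
    strictUp rk (fun a b => (x a b + y a b) / 2) v w
      = (strictUp rk x v w + strictUp rk y v w) / 2 := by
  simp only [strictUp, ← Finset.sum_add_distrib, Finset.sum_div]
  refine Finset.sum_congr rfl fun u _ => ?_
  split_ifs <;> ring

theorem midpoint (hx : FracStable A rk x) (hy : FracStable A rk y) :
    FracStable A rk (fun a b => (x a b + y a b) / 2) where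
  nonneg v w := by linarith [hx.nonneg v w, hy.nonneg v w]
  symm v w := by simp only [hx.symm v w, hy.symm v w]
  supp v w h := by simp only [hx.supp v w h, hy.supp v w h]; norm_num
  row_le v := by
    rw [← Finset.sum_div, Finset.sum_add_distrib]
    linarith [hx.row_le v, hy.row_le v]
  cover v w h := by
    rw [midpoint_weakUp, midpoint_strictUp]
    linarith [hx.cover v w h, hy.cover v w h]
  odd C hC := by
    simp only [← Finset.sum_div, Finset.sum_add_distrib]
    linarith [hx.odd C hC, hy.odd C hC]

theorem row_eq (hx : FracStable A rk x) (hy : FracStable A rk y) (v : V) :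
    ∑ w, x v w = ∑ w, y v w := by
  have h := (hx.midpoint hy).slack.1 v
  rw [← Finset.sum_div, Finset.sum_add_distrib] at h
  nlinarith [hx.slack.1 v, hy.slack.1 v, sq_nonneg (∑ w, x v w - ∑ w, y v w)]

theorem row_eq_one (hx : FracStable A rk x) {v w : V} (h : 0 < x v w) : ∑ u, x v u = 1 := by
  have h1 : x v w ≤ ∑ u, x v u :=
    Finset.single_le_sum (fun u _ => hx.nonneg v u) (Finset.mem_univ w)
  have h2 := hx.slack.1 v
  have h3 : (∑ u, x v u) * (∑ u, x v u - 1) = 0 := by linarith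
  rcases mul_eq_zero.1 h3 with h | h <;> linarith

/-- The covering constraint of an edge in the support of some fractional stable matching is tight
for all of them. -/
theorem tight (hx : FracStable A rk x) (hy : FracStable A rk y) {v w : V} (h : 0 < x v w) :
    weakUp rk y v w + strictUp rk y w v = 1 := by
  have hA : A v w := by
    by_contra hA
    linarith [hx.supp v w hA]
  have h1 := (hx.midpoint hy).slack.2 v w
  rw [midpoint_weakUp, midpoint_strictUp] at h1
  have h2 : (x v w + y v w) / 2 ≠ 0 := by linarith [hy.nonneg v w]
  have h3 := (mul_eq_zero.1 h1).resolve_left h2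
  linarith [hx.cover v w hA, hy.cover v w hA]

theorem weakUp_eq_sub (rk : V → V → ℕ) (y : V → V → ℝ) (v w : V) :
    weakUp rk y v w = ∑ u, y v u - ∑ u, if rk v u < rk v w then y v u else 0 := by
  rw [weakUp, ← Finset.sum_sub_distrib]
  refine Finset.sum_congr rfl fun u _ => ?_
  split_ifs <;> first | omega | ring

theorem strictUp_pos_iff (hy : FracStable A rk y) (v w : V) :
    0 < strictUp rk y v w ↔ ∃ u, 0 < y v u ∧ rk v w < rk v u := by
  constructor
  · intro h
    by_contra! hc
    refine h.ne' (Finset.sum_eq_zero fun u _ => ?_)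
    split_ifs with h1
    · by_contra h2
      exact absurd (hc u (lt_of_le_of_ne (hy.nonneg v u) (Ne.symm h2))) (by omega)
    · rfl
  · rintro ⟨u, hu, hr⟩
    refine Finset.sum_pos' (fun a _ => ?_) ⟨u, Finset.mem_univ u, by simpa [hr] using hu⟩
    split_ifs
    exacts [hy.nonneg v a, le_rfl]

theorem weakUp_lt_one_iff (hy : FracStable A rk y) {v : V} (w : V) (hv : ∑ u, y v u = 1) :
    weakUp rk y v w < 1 ↔ ∃ u, 0 < y v u ∧ rk v u < rk v w := by
  rw [weakUp_eq_sub, hv, sub_lt_self_iff]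
  constructor
  · intro h
    by_contra! hc
    refine h.ne' (Finset.sum_eq_zero fun u _ => ?_)
    split_ifs with h1
    · by_contra h2
      exact absurd (hc u (lt_of_le_of_ne (hy.nonneg v u) (Ne.symm h2))) (by omega)
    · rfl
  · rintro ⟨u, hu, hr⟩
    refine Finset.sum_pos' (fun a _ => ?_) ⟨u, Finset.mem_univ u, by simpa [hr] using hu⟩
    split_ifs
    exacts [hy.nonneg v a, le_rfl]

/-- Along an edge used by a fractional stable matching, one end has strictly worse partners
exactly when the other end has strictly better ones. -/
theorem exists_worse_iff_exists_better (hx : FracStable A rk x) (hy : FracStable A rk y)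
    {v w : V} (h : 0 < x v w) :
    (∃ u, 0 < y v u ∧ rk v u < rk v w) ↔ ∃ u, 0 < y w u ∧ rk w v < rk w u := by
  rw [← hy.strictUp_pos_iff, ← hy.weakUp_lt_one_iff w ((hx.row_eq hy v).symm.trans
    (hx.row_eq_one h))]
  have := hx.tight hy h
  constructor <;> intro <;> linarith

theorem weakUp_sub_strictUp_symm (hx : FracStable A rk x) {v w : V} (h : 0 < x v w) :
    weakUp rk x v w - strictUp rk x v w = weakUp rk x w v - strictUp rk x w v := by
  have h1 := hx.tight hx h
  have h2 := hx.tight hx (hx.symm v w ▸ h)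
  linarith

end FracStable
end Core

section Perfect

open Classical in
/-- A symmetric doubly stochastic matrix satisfying the odd set constraints supports a perfect
matching. -/
theorem exists_involution_of_odd_constraints {W : Type*} [Fintype W] (z : W → W → ℝ)
    (nonneg : ∀ a b, 0 ≤ z a b) (symm : ∀ a b, z a b = z b a) (diag : ∀ a, z a a = 0)
    (row : ∀ a, ∑ b, z a b = 1)
    (odd : ∀ C : Finset W, Odd C.card → ∑ a ∈ C, ∑ b ∈ C, z a b ≤ C.card - 1) :
    ∃ f : W → W, (∀ a, f (f a) = a) ∧ ∀ a, 0 < z a (f a) := by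
  let G : SimpleGraph W :=
    { Adj := fun a b => 0 < z a b
      symm := ⟨fun a b h => by rw [symm]; exact h⟩
      loopless := ⟨fun a h => h.ne' (diag a)⟩ }
  have key : ∀ u, ¬ G.IsTutteViolator u := by
    intro u hu
    rw [SimpleGraph.IsTutteViolator] at hu
    set H := ((⊤ : G.Subgraph).deleteVerts u).coe with hH
    let C : H.ConnectedComponent → Finset W := fun c => (Subtype.val '' c.supp).toFinset
    have hmem : ∀ c a, a ∈ C c ↔ ∃ h, H.connectedComponentMk ⟨a, h⟩ = c := by
      intro c a
      simp [C, SimpleGraph.ConnectedComponent.mem_supp_iff]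
    have hcard : ∀ c, (C c).card = c.supp.ncard := by
      intro c
      rw [← Set.ncard_eq_toFinset_card', Set.ncard_image_of_injective _ Subtype.val_injective]
    have hout : ∀ c, ∀ a ∈ C c, ∀ b, b ∉ u → b ∉ C c → z a b = 0 := by
      intro c a ha b hbu hbC
      by_contra hne
      obtain ⟨h, rfl⟩ := (hmem c a).1 ha
      have hadj : G.Adj a b := lt_of_le_of_ne (nonneg a b) (Ne.symm hne)
      have hb : b ∈ ((⊤ : G.Subgraph).deleteVerts u).verts := by simpa using hbu
      refine hbC ((hmem _ b).2 ⟨hb, ?_⟩)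
      rw [SimpleGraph.ConnectedComponent.eq]
      refine SimpleGraph.Adj.reachable ?_
      have hau : a ∉ u := by simpa using h
      simp [hH, hau, hbu, hadj.symm]
    have hone : ∀ c, Odd (C c).card → 1 ≤ ∑ a ∈ C c, ∑ b ∈ u.toFinset, z a b := by
      intro c hc
      have h1 : ((C c).card : ℝ) ≤ ∑ a ∈ C c, (∑ b ∈ C c, z a b + ∑ b ∈ u.toFinset, z a b) := by
        have : ((C c).card : ℝ) = ∑ a ∈ C c, ∑ b, z a b := by simp [row]
        rw [this]
        refine Finset.sum_le_sum fun a ha => ?_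
        have h2 : ∑ b, z a b = ∑ b ∈ C c ∪ u.toFinset, z a b := by
          symm
          refine Finset.sum_subset (Finset.subset_univ _) fun b _ hb => ?_
          simp only [Finset.mem_union, Set.mem_toFinset, not_or] at hb
          exact hout c a ha b hb.2 hb.1
        rw [h2, ← Finset.sum_union_inter]
        exact le_add_of_nonneg_right (Finset.sum_nonneg fun b _ => nonneg a b)
      rw [Finset.sum_add_distrib] at h1
      linarith [odd (C c) hc]
    have hdisj : Set.PairwiseDisjoint (↑H.oddComponents.toFinset) C := by
      intro c _ d _ hcd
      refine Finset.disjoint_left.2 fun a hc hd => hcd ?_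
      obtain ⟨_, rfl⟩ := (hmem c a).1 hc
      obtain ⟨_, rfl⟩ := (hmem d a).1 hd
      rfl
    have h1 : (H.oddComponents.ncard : ℝ) ≤ u.ncard := calc
      (H.oddComponents.ncard : ℝ) = ∑ c ∈ H.oddComponents.toFinset, 1 := by
        rw [Set.ncard_eq_toFinset_card']; simp
      _ ≤ ∑ c ∈ H.oddComponents.toFinset, ∑ a ∈ C c, ∑ b ∈ u.toFinset, z a b := by
        refine Finset.sum_le_sum fun c hc => hone c ?_
        rw [hcard]
        simpa using hc
      _ = ∑ a ∈ H.oddComponents.toFinset.biUnion C, ∑ b ∈ u.toFinset, z a b :=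
        (Finset.sum_biUnion hdisj).symm
      _ ≤ ∑ a, ∑ b ∈ u.toFinset, z a b :=
        Finset.sum_le_univ_sum_of_nonneg fun a => Finset.sum_nonneg fun b _ => nonneg a b
      _ = ∑ b ∈ u.toFinset, ∑ a, z b a := by
        rw [Finset.sum_comm]
        simp only [symm]
      _ = u.ncard := by
        simp only [row]
        rw [Set.ncard_eq_toFinset_card']; simp
    exact absurd hu (not_lt.2 (by exact_mod_cast h1))
  obtain ⟨M, hM⟩ := SimpleGraph.tutte.2 key
  rw [SimpleGraph.Subgraph.isPerfectMatching_iff] at hM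
  choose f hf huniq using hM
  exact ⟨f, fun a => (huniq _ _ (hf a).symm).symm, fun a => (hf a).adj_sub⟩

open Classical in
/-- Matrices of matchings satisfy the odd set constraints. -/
theorem sum_sum_le_of_zero_one {V : Type*} [Fintype V] (y : V → V → ℝ)
    (symm : ∀ a b, y a b = y b a) (diag : ∀ a, y a a = 0) (row_le : ∀ a, ∑ b, y a b ≤ 1)
    (zero_one : ∀ a b, y a b = 0 ∨ y a b = 1) (C : Finset V) (hC : Odd C.card) :
    ∑ a ∈ C, ∑ b ∈ C, y a b ≤ C.card - 1 := by
  have nonneg : ∀ a b, 0 ≤ y a b := fun a b => by rcases zero_one a b with h | h <;> simp [h]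
  have huniq : ∀ a b c, y a b = 1 → y a c = 1 → b = c := by
    intro a b c hb hc
    by_contra hne
    have := Finset.sum_le_univ_sum_of_nonneg (s := {b, c}) (nonneg a)
    rw [Finset.sum_pair hne, hb, hc] at this
    linarith [row_le a]
  let s := C.filter fun a => ∃ b ∈ C, y a b = 1
  have hp : ∀ a ∈ s, ∃ b ∈ C, y a b = 1 := fun a ha => (Finset.mem_filter.1 ha).2
  choose p hpC hp using hp
  have hps : ∀ a ha, p a ha ∈ s := fun a ha =>
    Finset.mem_filter.2 ⟨hpC a ha, a, (Finset.mem_filter.1 ha).1, by rw [symm]; exact hp a ha⟩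
  have heven : ∑ a ∈ s, (1 : ZMod 2) = 0 := by
    refine Finset.sum_involution p (fun _ _ => by decide) (fun a ha _ h => ?_) hps fun a ha => ?_
    · have := hp a ha
      rw [h, diag] at this
      exact zero_ne_one this
    · exact huniq (p a ha) _ _ (hp _ (hps a ha)) (by rw [symm]; exact hp a ha)
  have heven' : Even s.card := by
    rw [← ZMod.natCast_eq_zero_iff_even]
    simpa using heven
  have hlt : s.card < C.card := by
    refine lt_of_le_of_ne (Finset.card_filter_le _ _) fun h => ?_
    rw [h] at heven'
    exact Nat.not_even_iff_odd.2 hC heven'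
  have hle : ∑ a ∈ C, ∑ b ∈ C, y a b ≤ s.card := by
    rw [Finset.card_filter, Nat.cast_sum]
    refine Finset.sum_le_sum fun a _ => ?_
    split_ifs with h
    · exact (Finset.sum_le_univ_sum_of_nonneg (nonneg a)).trans (by simpa using row_le a)
    · push Not at h
      refine (Finset.sum_eq_zero fun b hb => (zero_one a b).resolve_right (h b hb)).le.trans ?_
      simp
  have : (s.card : ℝ) + 1 ≤ C.card := by exact_mod_cast hlt
  linarith

end Perfect

section Rounding
variable {V : Type*} [Fintype V]

open Classical in
/-- `exists_involution_of_odd_constraints` on the vertices satisfying `K`. -/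
theorem exists_involution_on_of_odd_constraints (K : V → Prop) (z : V → V → ℝ)
    (nonneg : ∀ a b, 0 ≤ z a b) (symm : ∀ a b, z a b = z b a) (diag : ∀ a, z a a = 0)
    (row : ∀ a, K a → ∑ b, z a b = 1) (supp : ∀ a b, ¬ K a → z a b = 0)
    (odd : ∀ C : Finset V, Odd C.card → ∑ a ∈ C, ∑ b ∈ C, z a b ≤ C.card - 1) :
    ∃ f : V → V, ∀ a, K a → K (f a) ∧ f (f a) = a ∧ 0 < z a (f a) := by
  have hrow : ∀ a : {a // K a}, ∑ b : {a // K a}, z a b = 1 := by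
    intro a
    rw [← row a a.2, ← Fintype.sum_subtype_add_sum_subtype K]
    refine (add_eq_left.2 (Finset.sum_eq_zero fun b _ => ?_)).symm
    rw [symm, supp b a b.2]
  have hodd : ∀ C : Finset {a // K a}, Odd C.card →
      ∑ a ∈ C, ∑ b ∈ C, z a b ≤ C.card - 1 := by
    intro C hC
    have := odd (C.map (Function.Embedding.subtype K)) (by simpa using hC)
    simpa using this
  obtain ⟨f, hf, hz⟩ := exists_involution_of_odd_constraints
    (fun a b : {a // K a} => z a b) (fun a b => nonneg a b) (fun a b => symm a b)
    (fun a => diag a) hrow hodd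
  refine ⟨fun a => if h : K a then f ⟨a, h⟩ else a, fun a ha => ?_⟩
  simp only [ha, dif_pos, (f ⟨a, ha⟩).2, Subtype.coe_eta, hf, true_and]
  exact hz ⟨a, ha⟩

open Classical in
theorem sum_sum_le_of_subset {z : V → V → ℝ} (row_le : ∀ a, ∑ b, z a b ≤ 1)
    (nonneg : ∀ a b, 0 ≤ z a b) {C D : Finset V} (hD : D ⊆ C)
    (h : ∑ a ∈ D, ∑ b ∈ C, z a b ≤ D.card - 1) : ∑ a ∈ C, ∑ b ∈ C, z a b ≤ C.card - 1 := by
  have h1 : ∑ a ∈ C \ D, ∑ b ∈ C, z a b ≤ (C \ D).card := by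
    rw [Finset.card_eq_sum_ones, Nat.cast_sum]
    refine Finset.sum_le_sum fun a _ => ?_
    exact (Finset.sum_le_univ_sum_of_nonneg (nonneg a)).trans (by simpa using row_le a)
  have h2 : ((C \ D).card : ℝ) + D.card = C.card := by
    exact_mod_cast Finset.card_sdiff_add_card_eq_card hD
  rw [← Finset.sum_sdiff hD]
  linarith

theorem sum_sum_filter_le {z x : V → V → ℝ} (q : V → Prop) [DecidablePred q]
    (hzx : ∀ a b, q a → z a b ≤ x a b)
    (hq : ∀ a b, q a → ¬ q b → z a b = 0)
    (odd : ∀ C : Finset V, Odd C.card → ∑ a ∈ C, ∑ b ∈ C, x a b ≤ C.card - 1)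
    (C : Finset V) (hC : Odd (C.filter q).card) :
    ∑ a ∈ C.filter q, ∑ b ∈ C, z a b ≤ (C.filter q).card - 1 := by
  refine le_trans (Finset.sum_le_sum fun a ha => ?_) (odd _ hC)
  have hqa := (Finset.mem_filter.1 ha).2
  rw [Finset.sum_filter]
  refine Finset.sum_le_sum fun b _ => ?_
  split_ifs with hb
  exacts [hzx a b hqa, (hq a b hqa hb).le]

open Classical in
/-- Odd set constraints for a matrix splitting into two parts dominated by matrices satisfying
these constraints, and a bipartite part. -/
theorem odd_constraints_of_classes {z x s : V → V → ℝ} (lo hi : V → Prop)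
    (nonneg : ∀ a b, 0 ≤ z a b) (symm : ∀ a b, z a b = z b a) (row_le : ∀ a, ∑ b, z a b ≤ 1)
    (hcls : ∀ a b, 0 < z a b → (lo a ↔ hi b))
    (hzx : ∀ a b, ¬ lo a ∧ ¬ hi a → z a b ≤ x a b) (hzs : ∀ a b, lo a ∧ hi a → z a b ≤ s a b)
    (oddx : ∀ C : Finset V, Odd C.card → ∑ a ∈ C, ∑ b ∈ C, x a b ≤ C.card - 1)
    (odds : ∀ C : Finset V, Odd C.card → ∑ a ∈ C, ∑ b ∈ C, s a b ≤ C.card - 1)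
    (C : Finset V) (hC : Odd C.card) : ∑ a ∈ C, ∑ b ∈ C, z a b ≤ C.card - 1 := by
  have hcls' : ∀ a b, z a b ≠ 0 → (lo a ↔ hi b) ∧ (lo b ↔ hi a) := by
    intro a b h
    have h' := lt_of_le_of_ne (nonneg a b) (Ne.symm h)
    exact ⟨hcls a b h', hcls b a (symm a b ▸ h')⟩
  by_cases hR : Odd (C.filter fun a => ¬ lo a ∧ ¬ hi a).card
  · refine sum_sum_le_of_subset row_le nonneg (Finset.filter_subset _ _)
      (sum_sum_filter_le _ hzx (fun a b ha hb => ?_) oddx C hR)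
    by_contra hne
    have := hcls' a b hne
    tauto
  by_cases hM : Odd (C.filter fun a => lo a ∧ hi a).card
  · refine sum_sum_le_of_subset row_le nonneg (Finset.filter_subset _ _)
      (sum_sum_filter_le _ hzs (fun a b ha hb => ?_) odds C hM)
    by_contra hne
    have := hcls' a b hne
    tauto
  have hbip : ∀ (q r : V → Prop) [DecidablePred q] [DecidablePred r],
      (∀ a b, q a → ¬ r b → z a b = 0) →
      (C.filter r).card < (C.filter q).card →
      ∑ a ∈ C.filter q, ∑ b ∈ C, z a b ≤ (C.filter q).card - 1 := by
    intro q r _ _ hqr hlt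
    have h1 : ∑ a ∈ C.filter q, ∑ b ∈ C, z a b ≤ (C.filter r).card := calc
      _ = ∑ a ∈ C.filter q, ∑ b ∈ C.filter r, z a b := by
        refine Finset.sum_congr rfl fun a ha => ?_
        rw [Finset.sum_filter]
        refine Finset.sum_congr rfl fun b _ => ?_
        split_ifs with hb
        exacts [rfl, hqr a b (Finset.mem_filter.1 ha).2 hb]
      _ = ∑ b ∈ C.filter r, ∑ a ∈ C.filter q, z b a := by
        rw [Finset.sum_comm]
        simp only [symm]
      _ ≤ ∑ b ∈ C.filter r, 1 := Finset.sum_le_sum fun b _ =>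
        (Finset.sum_le_univ_sum_of_nonneg (nonneg b)).trans (row_le b)
      _ = (C.filter r).card := by simp
    have h2 : ((C.filter r).card : ℝ) + 1 ≤ (C.filter q).card := by exact_mod_cast hlt
    linarith
  have hcard : C.card = (C.filter fun a => ¬ lo a ∧ ¬ hi a).card
      + (C.filter fun a => lo a ∧ hi a).card + (C.filter fun a => lo a ∧ ¬ hi a).card
      + (C.filter fun a => hi a ∧ ¬ lo a).card := by
    simp only [Finset.card_filter, ← Finset.sum_add_distrib]
    rw [Finset.card_eq_sum_ones]
    refine Finset.sum_congr rfl fun a _ => ?_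
    by_cases h1 : lo a <;> by_cases h2 : hi a <;> simp [h1, h2]
  rw [Nat.not_odd_iff_even] at hR hM
  have hne : (C.filter fun a => lo a ∧ ¬ hi a).card ≠ (C.filter fun a => hi a ∧ ¬ lo a).card := by
    intro h
    rw [hcard, h] at hC
    obtain ⟨i, hi⟩ := hR
    obtain ⟨j, hj⟩ := hM
    obtain ⟨k, hk⟩ := hC
    omega
  rcases lt_or_gt_of_ne hne with h | h
  · refine sum_sum_le_of_subset row_le nonneg (Finset.filter_subset _ _) (hbip _ _ ?_ h)
    intro a b ha hb
    by_contra hz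
    have := hcls' a b hz
    tauto
  · refine sum_sum_le_of_subset row_le nonneg (Finset.filter_subset _ _) (hbip _ _ ?_ h)
    intro a b ha hb
    by_contra hz
    have := hcls' a b hz
    tauto

end Rounding

namespace FracStable
variable {V : Type*} [Fintype V] {A : V → V → Prop} {rk : V → V → ℕ} {x s : V → V → ℝ}

/-- The partner `b` is an extreme partner of `a` in the support of `x`, on the side of the partner
`c` of `a`. -/
def Extreme (rk : V → V → ℕ) (x : V → V → ℝ) (a b c : V) : Prop :=
  ((∀ u, 0 < x a u → rk a b ≤ rk a u) ∧ rk a c ≤ rk a b) ∨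
    ((∀ u, 0 < x a u → rk a u ≤ rk a b) ∧ rk a b ≤ rk a c)

/-- `b` is a median of `c` and the best and the worst partner of `a` in the support of `x`, and
meets the condition at `a` for the edge `ab` to belong to `T_x`. -/
def Median (rk : V → V → ℕ) (x : V → V → ℝ) (a b c : V) : Prop :=
  (∃ u, 0 < x a u ∧ rk a u ≤ rk a b) ∧
    (rk a c ≤ rk a b ∨ ∀ u, 0 < x a u → rk a u ≤ rk a b) ∧
    ((0 < x a b ∧ ((∀ u, 0 < x a u → rk a u ≤ rk a b) ∨ ∀ u, 0 < x a u → rk a b ≤ rk a u)) ∨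
      ((∃ u, 0 < x a u ∧ rk a b < rk a u) ∧ ∃ u, 0 < x a u ∧ rk a u < rk a b))

theorem exists_pos_of_row {a : V} (ha : ∑ b, x a b = 1) :
    ∃ b, 0 < x a b := by
  by_contra! h
  have : ∑ b, x a b ≤ 0 := Finset.sum_nonpos fun b _ => h b
  linarith

open Classical in
theorem eq_of_row_le_one {y : V → V → ℝ} (nonneg : ∀ a b, 0 ≤ y a b)
    (row_le : ∀ a, ∑ b, y a b ≤ 1) {a b c : V} (hb : y a b = 1) (hc : 0 < y a c) : c = b := by
  by_contra hne
  have := Finset.sum_le_univ_sum_of_nonneg (s := {c, b}) (nonneg a)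
  rw [Finset.sum_pair hne, hb] at this
  linarith [row_le a]

theorem exists_partner (h01 : ∀ a b, s a b = 0 ∨ s a b = 1) :
    ∃ p : V → V, ∀ a, ∑ b, s a b = 1 → s a (p a) = 1 := by
  have : ∀ a, ∃ b, ∑ b, s a b = 1 → s a b = 1 := by
    intro a
    by_cases ha : ∑ b, s a b = 1
    · obtain ⟨b, hb⟩ := exists_pos_of_row ha
      exact ⟨b, fun _ => (h01 a b).resolve_left hb.ne'⟩
    · exact ⟨a, fun h => absurd h ha⟩
  choose p hp using this
  exact ⟨p, hp⟩

/-- `x a b` divided by the total weight on the partners that `a` finds equivalent to `b`, which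
makes each indifference class of the support a fractional perfect matching. -/
noncomputable def classShare (rk : V → V → ℕ) (x : V → V → ℝ) (a b : V) : ℝ :=
  x a b / ∑ u, if rk a u = rk a b then x a u else 0

theorem classSum_eq (rk : V → V → ℕ) (x : V → V → ℝ) (a b : V) :
    (∑ u, if rk a u = rk a b then x a u else 0) = weakUp rk x a b - strictUp rk x a b := by
  rw [weakUp, strictUp, ← Finset.sum_sub_distrib]
  refine Finset.sum_congr rfl fun u _ => ?_
  split_ifs <;> first | omega | ring

theorem classShare_symm (hx : FracStable A rk x) {a b : V} (h : 0 < x a b) :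
    classShare rk x a b = classShare rk x b a := by
  rw [classShare, classShare, classSum_eq, classSum_eq, hx.weakUp_sub_strictUp_symm h, hx.symm]

theorem classShare_nonneg (hx : FracStable A rk x) (a b : V) : 0 ≤ classShare rk x a b := by
  refine div_nonneg (hx.nonneg a b) (Finset.sum_nonneg fun u _ => ?_)
  split_ifs
  exacts [hx.nonneg a u, le_rfl]

theorem classSum_pos (hx : FracStable A rk x) {a b : V} (h : 0 < x a b) :
    0 < ∑ u, if rk a u = rk a b then x a u else 0 := by
  refine Finset.sum_pos' (fun u _ => ?_) ⟨b, Finset.mem_univ b, by simpa using h⟩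
  split_ifs
  exacts [hx.nonneg a u, le_rfl]

theorem sum_classShare (hx : FracStable A rk x) {a b : V} (h : 0 < x a b) :
    (∑ u, if rk a u = rk a b then classShare rk x a u else 0) = 1 := by
  rw [← div_self (hx.classSum_pos h).ne', Finset.sum_div]
  refine Finset.sum_congr rfl fun u _ => ?_
  split_ifs with hu
  · rw [classShare, hu]
  · simp

theorem classShare_of_flat (hx : FracStable A rk x) {a b : V} (h : 0 < x a b)
    (hflat : ∀ u, 0 < x a u → rk a u = rk a b) : classShare rk x a b = x a b := by
  have : (∑ u, if rk a u = rk a b then x a u else 0) = 1 := by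
    rw [← hx.row_eq_one h]
    refine Finset.sum_congr rfl fun u _ => ?_
    split_ifs with hu
    · rfl
    · by_contra hne
      exact hu (hflat u (lt_of_le_of_ne (hx.nonneg a u) hne))
  rw [classShare, this, div_one]

open Classical in
/-- A perfect matching on the covered vertices, all of whose edges are medians at both ends. -/
theorem exists_median_matching (hA : ∀ a, ¬ A a a) (hx : FracStable A rk x)
    (hs : FracStable A rk s) {p : V → V} (hp : ∀ a, ∑ b, x a b = 1 → s a (p a) = 1) :
    ∃ f : V → V, ∀ a, ∑ b, x a b = 1 →
      ∑ b, x (f a) b = 1 ∧ f (f a) = a ∧ A a (f a) ∧ Median rk x a (f a) (p a) := by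
  let lo : V → Prop := fun a => ∃ u, 0 < x a u ∧ rk a u < rk a (p a)
  let hi : V → Prop := fun a => ∃ u, 0 < x a u ∧ rk a (p a) < rk a u
  let z : V → V → ℝ := fun a b =>
    if 0 < x a b ∧ Extreme rk x a b (p a) then classShare rk x a b
    else if lo a ∧ hi a ∧ p a = b then 1 else 0
  have rowlo : ∀ a, lo a → ∑ b, x a b = 1 := fun a ⟨_, hu, _⟩ => hx.row_eq_one hu
  have hpp : ∀ a, ∑ b, x a b = 1 → ∑ b, x (p a) b = 1 ∧ p (p a) = a := by
    intro a ha
    have h1 : s (p a) a = 1 := by rw [hs.symm]; exact hp a ha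
    have h2 : ∑ b, x (p a) b = 1 := by
      rw [hx.row_eq hs]
      exact hs.row_eq_one (h1 ▸ one_pos)
    exact ⟨h2, eq_of_row_le_one hs.nonneg hs.row_le h1 (by rw [hp _ h2]; exact one_pos)⟩
  have hpu : ∀ a b, ∑ b, x a b = 1 → 0 < s a b → b = p a := fun a b ha hb =>
    eq_of_row_le_one hs.nonneg hs.row_le (hp a ha) hb
  have hlohi : ∀ a, ∑ b, x a b = 1 → (lo a ↔ hi (p a)) := by
    intro a ha
    have := hs.exists_worse_iff_exists_better hx (v := a) (w := p a) (by rw [hp a ha]; exact one_pos)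
    simp only [lo, hi, (hpp a ha).2]
    exact this
  have hworse : ∀ a b, 0 < x a b → (rk a (p a) < rk a b ↔ rk b a < rk b (p b)) := by
    intro a b hab
    have ha := hx.row_eq_one hab
    have hb := hx.row_eq_one (hx.symm a b ▸ hab)
    have := hx.exists_worse_iff_exists_better hs hab
    constructor
    · intro h
      obtain ⟨u, hu, hr⟩ := this.1 ⟨p a, by rw [hp a ha]; exact one_pos, h⟩
      rwa [hpu b u hb hu] at hr
    · intro h
      obtain ⟨u, hu, hr⟩ := this.2 ⟨p b, by rw [hp b hb]; exact one_pos, h⟩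
      rwa [hpu a u ha hu] at hr
  have hext : ∀ a b, 0 < x a b →
      (((∀ u, 0 < x a u → rk a b ≤ rk a u) ∧ rk a (p a) ≤ rk a b) ↔
        ((∀ u, 0 < x b u → rk b u ≤ rk b a) ∧ rk b a ≤ rk b (p b))) := by
    intro a b hab
    have h1 := not_congr (hx.exists_worse_iff_exists_better hx hab)
    have h2 := not_congr (hworse b a (hx.symm a b ▸ hab))
    push Not at h1 h2
    rw [h1, ← h2]
  have hext_symm : ∀ a b, 0 < x a b → Extreme rk x a b (p a) → Extreme rk x b a (p b) := by
    intro a b hab h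
    have hba := hx.symm a b ▸ hab
    exact h.elim (fun h => Or.inr ((hext a b hab).1 h)) fun h => Or.inl ((hext b a hba).2 h)
  have hext_not : ∀ a b, Extreme rk x a b (p a) → ¬ (lo a ∧ hi a) := by
    rintro a b (⟨h1, h2⟩ | ⟨h1, h2⟩) ⟨⟨u, hu, hu'⟩, v, hv, hv'⟩
    · have := h1 u hu
      omega
    · have := h1 v hv
      omega
  have nonneg : ∀ a b, 0 ≤ z a b := by
    intro a b
    simp only [z]
    split_ifs
    exacts [hx.classShare_nonneg a b, zero_le_one, le_rfl]
  have hcls : ∀ a b, 0 < z a b → (lo a ↔ hi b) := by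
    intro a b hz
    simp only [z] at hz
    split_ifs at hz with h1 h2
    · obtain ⟨hab, he⟩ := h1
      have hba := hx.symm a b ▸ hab
      have hlo : ∀ c d, 0 < x c d → Extreme rk x c d (p c) → ¬ lo c → ¬ hi d := by
        intro c d hcd he hlo ⟨u, hu, hu'⟩
        have hlo' : ∀ u, 0 < x c u → rk c (p c) ≤ rk c u := by
          simpa only [lo, not_exists, not_and, not_lt] using hlo
        have := (hext c d hcd).1 <| by
          rcases he with he | ⟨h1, h2⟩
          · exact he
          · exact ⟨fun u hu => h2.trans (hlo' u hu), hlo' d hcd⟩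
        have h3 := this.1 u hu
        omega
      have hhi : ∀ c d, 0 < x c d → Extreme rk x c d (p c) → ¬ hi c → ¬ lo d := by
        intro c d hcd he hhi ⟨u, hu, hu'⟩
        have hhi' : ∀ u, 0 < x c u → rk c u ≤ rk c (p c) := by
          simpa only [hi, not_exists, not_and, not_lt] using hhi
        have := (hext d c (hx.symm c d ▸ hcd)).2 <| by
          rcases he with ⟨h1, h2⟩ | he
          · exact ⟨fun u hu => (hhi' u hu).trans h2, hhi' d hcd⟩
          · exact he
        have h3 := this.1 u hu
        omega
      have h3 := hlo a b hab he
      have h4 := hhi b a hba (hext_symm a b hab he)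
      exact not_iff_not.1 ⟨h3, h4⟩
    · obtain ⟨h3, -, rfl⟩ := h2
      exact hlohi a (rowlo a h3)
    · exact absurd hz (lt_irrefl _)
  have symm' : ∀ a b, 0 < z a b → z b a = z a b := by
    intro a b hz
    simp only [z] at hz ⊢
    split_ifs at hz with h1 h2
    · have hba := hx.symm a b ▸ h1.1
      rw [if_pos h1, if_pos ⟨hba, hext_symm a b h1.1 h1.2⟩, hx.classShare_symm h1.1]
    · obtain ⟨hlo, hhi, rfl⟩ := h2
      have ha := rowlo a hlo
      have h3 := hpp a ha
      have h4 : lo (p a) ∧ hi (p a) := by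
        have h5 := hlohi (p a) h3.1
        rw [h3.2] at h5
        exact ⟨h5.2 hhi, (hlohi a ha).1 hlo⟩
      rw [if_neg (fun h => hext_not _ _ h.2 h4 : ¬ (0 < x (p a) a ∧ _)),
        if_pos ⟨h4.1, h4.2, h3.2⟩, if_neg h1, if_pos ⟨hlo, hhi, rfl⟩]
    · exact absurd hz (lt_irrefl _)
  have symm : ∀ a b, z a b = z b a := by
    intro a b
    rcases (nonneg a b).lt_or_eq with h | h
    · exact (symm' a b h).symm
    · rcases (nonneg b a).lt_or_eq with h' | h'
      · exact symm' b a h'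
      · rw [← h, ← h']
  have supp : ∀ a b, 0 < z a b → A a b := by
    intro a b hz
    by_contra hab
    simp only [z] at hz
    split_ifs at hz with h1 h2
    · exact h1.1.ne' (hx.supp a b hab)
    · obtain ⟨h3, -, rfl⟩ := h2
      have := hp a (rowlo a h3)
      rw [hs.supp _ _ hab] at this
      exact zero_ne_one this
    · exact lt_irrefl _ hz
  have row : ∀ a, ∑ b, x a b = 1 → ∑ b, z a b = 1 := by
    intro a ha
    by_cases hM : lo a ∧ hi a
    · refine Eq.trans (Finset.sum_congr rfl fun b _ => ?_)
        ((Finset.sum_ite_eq Finset.univ (p a) fun _ => (1 : ℝ)).trans (by simp))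
      simp only [z]
      rw [if_neg fun h => hext_not _ _ h.2 hM]
      simp [hM]
    · have : ∃ b, 0 < x a b ∧ Extreme rk x a b (p a) := by
        have hne : (Finset.univ.filter fun b => 0 < x a b).Nonempty := by
          obtain ⟨b, hb⟩ := exists_pos_of_row ha
          exact ⟨b, by simpa using hb⟩
        by_cases hlo : lo a
        · have hhi' : ∀ u, 0 < x a u → rk a u ≤ rk a (p a) := by
            have : ¬ hi a := fun h => hM ⟨hlo, h⟩
            simpa only [hi, not_exists, not_and, not_lt] using this
          obtain ⟨b, hb, hmax⟩ := Finset.exists_max_image _ (rk a) hne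
          simp only [Finset.mem_filter, Finset.mem_univ, true_and] at hb hmax
          exact ⟨b, hb, Or.inr ⟨hmax, hhi' b hb⟩⟩
        · have hlo' : ∀ u, 0 < x a u → rk a (p a) ≤ rk a u := by
            simpa only [lo, not_exists, not_and, not_lt] using hlo
          obtain ⟨b, hb, hmin⟩ := Finset.exists_min_image _ (rk a) hne
          simp only [Finset.mem_filter, Finset.mem_univ, true_and] at hb hmin
          exact ⟨b, hb, Or.inl ⟨hmin, hlo' b hb⟩⟩
      obtain ⟨b, hb, he⟩ := this
      rw [← hx.sum_classShare hb]
      refine Finset.sum_congr rfl fun u _ => ?_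
      simp only [z]
      rw [if_neg (fun h => hM ⟨h.1, h.2.1⟩ : ¬ (lo a ∧ hi a ∧ p a = u))]
      rcases (hx.nonneg a u).lt_or_eq with hu | hu
      · refine if_congr ?_ rfl rfl
        simp only [hu, true_and]
        constructor
        · intro he'
          have h1 : ∀ v w, 0 < x a v → Extreme rk x a w (p a) → Extreme rk x a v (p a) →
            0 < x a w → rk a v ≤ rk a w := by
            rintro v w hv (⟨h1, h2⟩ | ⟨h1, h2⟩) (⟨h3, h4⟩ | ⟨h3, h4⟩) hw
            · exact h3 w hw
            · exact h4.trans h2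
            · exact h1 v hv
            · exact h1 v hv
          exact le_antisymm (h1 u b hu he he' hb) (h1 b u hb he' he hu)
        · intro h
          simpa only [Extreme, h] using he
      · simp [classShare, ← hu]
  have supp' : ∀ a b, ¬ ∑ b, x a b = 1 → z a b = 0 := by
    intro a b ha
    simp only [z]
    rw [if_neg fun h => ha (hx.row_eq_one h.1), if_neg fun h => ha (rowlo a h.1)]
  have row_le : ∀ a, ∑ b, z a b ≤ 1 := by
    intro a
    by_cases ha : ∑ b, x a b = 1
    · exact (row a ha).le
    · rw [Finset.sum_eq_zero fun b _ => supp' a b ha]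
      exact zero_le_one
  have hzx : ∀ a b, ¬ lo a ∧ ¬ hi a → z a b ≤ x a b := by
    rintro a b ⟨hlo, hhi⟩
    simp only [z]
    rw [if_neg (fun h => hlo h.1 : ¬ (lo a ∧ hi a ∧ p a = b))]
    split_ifs with h
    · refine (hx.classShare_of_flat h.1 fun u hu => ?_).le
      have h1 : ∀ u, 0 < x a u → rk a (p a) ≤ rk a u := by
        simpa only [lo, not_exists, not_and, not_lt] using hlo
      have h2 : ∀ u, 0 < x a u → rk a u ≤ rk a (p a) := by
        simpa only [hi, not_exists, not_and, not_lt] using hhi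
      have := h1 u hu
      have := h1 b h.1
      have := h2 u hu
      have := h2 b h.1
      omega
    · exact hx.nonneg a b
  have hzs : ∀ a b, lo a ∧ hi a → z a b ≤ s a b := by
    intro a b hM
    simp only [z]
    rw [if_neg fun h => hext_not _ _ h.2 hM]
    split_ifs with h
    · rw [← h.2.2, hp a (rowlo a hM.1)]
    · exact hs.nonneg a b
  have diag : ∀ a, z a a = 0 := fun a => by
    by_contra h
    exact hA a (supp a a (lt_of_le_of_ne (nonneg a a) (Ne.symm h)))
  obtain ⟨f, hf⟩ := exists_involution_on_of_odd_constraints (fun a => ∑ b, x a b = 1) z nonneg symm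
    diag row supp' (odd_constraints_of_classes lo hi nonneg symm row_le hcls hzx hzs hx.odd hs.odd)
  refine ⟨f, fun a ha => ⟨(hf a ha).1, (hf a ha).2.1, supp _ _ (hf a ha).2.2, ?_⟩⟩
  have hz := (hf a ha).2.2
  simp only [z] at hz
  split_ifs at hz with h1 h2
  · obtain ⟨hb, he⟩ := h1
    refine ⟨⟨_, hb, le_rfl⟩, ?_, Or.inl ⟨hb, ?_⟩⟩
    · exact he.imp (fun h => h.2) fun h => h.1
    · exact he.symm.imp (fun h => h.1) fun h => h.1
  · obtain ⟨⟨u, hu, hu'⟩, hhi, h3⟩ := h2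
    rw [← h3]
    exact ⟨⟨u, hu, hu'.le⟩, Or.inl le_rfl, Or.inr ⟨hhi, u, hu, hu'⟩⟩
  · exact absurd hz (lt_irrefl _)

end FracStable

namespace FracStable
variable {V : Type*} [Fintype V] {A : V → V → Prop} {rk : V → V → ℕ} {x y s : V → V → ℝ}

theorem weakUp_pos_iff (hy : FracStable A rk y) (v w : V) :
    0 < weakUp rk y v w ↔ ∃ u, 0 < y v u ∧ rk v w ≤ rk v u := by
  constructor
  · intro h
    by_contra! hc
    refine h.ne' (Finset.sum_eq_zero fun u _ => ?_)
    split_ifs with h1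
    · by_contra h2
      exact absurd (hc u (lt_of_le_of_ne (hy.nonneg v u) (Ne.symm h2))) (by omega)
    · rfl
  · rintro ⟨u, hu, hr⟩
    refine Finset.sum_pos' (fun a _ => ?_) ⟨u, Finset.mem_univ u, by simpa [hr] using hu⟩
    split_ifs
    exacts [hy.nonneg v a, le_rfl]

theorem strictUp_le_row (hy : FracStable A rk y) (v w : V) :
    strictUp rk y v w ≤ ∑ u, y v u := by
  refine Finset.sum_le_sum fun u _ => ?_
  split_ifs
  exacts [le_rfl, hy.nonneg v u]

theorem rk_lt_of_one_le_strictUp (hy : FracStable A rk y) {v w u : V}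
    (h : 1 ≤ strictUp rk y v w) (hu : 0 < y v u) : rk v w < rk v u := by
  by_contra hc
  have : strictUp rk y v w < ∑ u, y v u := by
    refine Finset.sum_lt_sum (fun u _ => ?_) ⟨u, Finset.mem_univ u, by simpa [hc] using hu⟩
    split_ifs
    exacts [le_rfl, hy.nonneg v u]
  linarith [hy.row_le v]

/-- The covering constraint only depends on the medians. -/
theorem cover_of_median (hx : FracStable A rk x) (hs : FracStable A rk s) {p f : V → V}
    (hpu : ∀ a b, 0 < s a b → b = p a)
    (hf : ∀ a, ∑ b, x a b = 1 → Median rk x a (f a) (p a)) {v w : V} (hvw : A v w) :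
    (∑ b, x v b = 1 ∧ rk v w ≤ rk v (f v)) ∨ (∑ b, x w b = 1 ∧ rk w v < rk w (f w)) := by
  have hc := hx.cover v w hvw
  by_cases h0 : 0 < weakUp rk x v w
  · obtain ⟨u, hu, huw⟩ := (hx.weakUp_pos_iff v w).1 h0
    have hv := hx.row_eq_one hu
    by_cases h1 : weakUp rk x v w < 1
    · obtain ⟨t, ht, htv⟩ := (hx.strictUp_pos_iff w v).1 (by linarith)
      have hw := hx.row_eq_one ht
      have hsc := hs.cover v w hvw
      by_cases h2 : 0 < weakUp rk s v w
      · obtain ⟨q, hq, hqw⟩ := (hs.weakUp_pos_iff v w).1 h2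
        rw [hpu v q hq] at hqw
        refine Or.inl ⟨hv, ?_⟩
        rcases (hf v hv).2.1 with h | h
        · exact hqw.trans h
        · exact huw.trans (h u hu)
      · obtain ⟨q, hq, hqv⟩ := (hs.strictUp_pos_iff w v).1 (by linarith)
        rw [hpu w q hq] at hqv
        refine Or.inr ⟨hw, ?_⟩
        rcases (hf w hw).2.1 with h | h
        · exact hqv.trans_le h
        · exact htv.trans_le (h t ht)
    · refine Or.inl ⟨hv, ?_⟩
      rw [hx.weakUp_lt_one_iff w hv] at h1
      push Not at h1
      obtain ⟨u, hu, hr⟩ := (hf v hv).1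
      exact (h1 u hu).trans hr
  · have h1 : 1 ≤ strictUp rk x w v := by linarith
    have hw : ∑ b, x w b = 1 := le_antisymm (hx.row_le w) (h1.trans (hx.strictUp_le_row w v))
    obtain ⟨u, hu, hr⟩ := (hf w hw).1
    exact Or.inr ⟨hw, (hx.rk_lt_of_one_le_strictUp h1 hu).trans_le hr⟩

open Classical in
/-- If there is an integral fractional stable matching, then every fractional stable matching can
be rounded to an integral one by edges which are medians at both ends. -/
theorem exists_integral (hA : ∀ a, ¬ A a a) (hx : FracStable A rk x)
    (hs : FracStable A rk s) (h01 : ∀ a b, s a b = 0 ∨ s a b = 1) :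
    ∃ y, FracStable A rk y ∧ (∀ a b, y a b = 0 ∨ y a b = 1) ∧
      ∀ a b, y a b ≠ 0 → ∑ u, x a u = 1 ∧ ∃ c, Median rk x a b c := by
  obtain ⟨p, hp⟩ := exists_partner h01
  have hp' : ∀ a, ∑ b, x a b = 1 → s a (p a) = 1 := fun a ha => hp a ((hx.row_eq hs a) ▸ ha)
  have hpu : ∀ a b, 0 < s a b → b = p a := fun a b hb =>
    eq_of_row_le_one hs.nonneg hs.row_le (hp a (hs.row_eq_one hb)) hb
  obtain ⟨f, hf⟩ := hx.exists_median_matching hA hs hp'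
  let y : V → V → ℝ := fun a b => if ∑ u, x a u = 1 ∧ f a = b then 1 else 0
  have h01' : ∀ a b, y a b = 0 ∨ y a b = 1 := fun a b => by
    simp only [y]
    split_ifs <;> simp
  have nonneg : ∀ a b, 0 ≤ y a b := fun a b => by
    rcases h01' a b with h | h <;> simp [h]
  have yf : ∀ a, ∑ u, x a u = 1 → y a (f a) = 1 := fun a ha => by simp [y, ha]
  have symm : ∀ a b, y a b = y b a := by
    intro a b
    refine if_congr ?_ rfl rfl
    constructor
    · rintro ⟨ha, rfl⟩
      exact ⟨(hf a ha).1, (hf a ha).2.1⟩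
    · rintro ⟨hb, rfl⟩
      exact ⟨(hf b hb).1, (hf b hb).2.1⟩
  have supp : ∀ a b, ¬ A a b → y a b = 0 := by
    intro a b hab
    refine if_neg ?_
    rintro ⟨ha, rfl⟩
    exact hab (hf a ha).2.2.1
  have row_le : ∀ a, ∑ b, y a b ≤ 1 := by
    intro a
    by_cases ha : ∑ u, x a u = 1 <;> simp [y, ha]
  refine ⟨y, ⟨nonneg, symm, supp, row_le, fun v w hvw => ?_, ?_⟩, h01', fun a b hab => ?_⟩
  · have hw0 : 0 ≤ weakUp rk y v w := Finset.sum_nonneg fun u _ => by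
      split_ifs
      exacts [nonneg v u, le_rfl]
    have hs0 : 0 ≤ strictUp rk y w v := Finset.sum_nonneg fun u _ => by
      split_ifs
      exacts [nonneg w u, le_rfl]
    rcases hx.cover_of_median hs hpu (fun a ha => (hf a ha).2.2.2) hvw with ⟨hv, h⟩ | ⟨hw, h⟩
    · have := Finset.single_le_sum (f := fun u => if rk v w ≤ rk v u then y v u else 0)
        (fun u _ => by split_ifs; exacts [nonneg v u, le_rfl]) (Finset.mem_univ (f v))
      simp only [h, if_true, yf v hv] at this
      rw [weakUp] at *
      linarith
    · have := Finset.single_le_sum (f := fun u => if rk w v < rk w u then y w u else 0)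
        (fun u _ => by split_ifs; exacts [nonneg w u, le_rfl]) (Finset.mem_univ (f w))
      simp only [h, if_true, yf w hw] at this
      rw [strictUp] at *
      linarith
  · exact sum_sum_le_of_zero_one y symm (fun a => supp a a (hA a)) row_le h01'
  · have h : ∑ u, x a u = 1 ∧ f a = b := by
      by_contra h
      exact hab (if_neg h)
    obtain ⟨ha, rfl⟩ := h
    exact ⟨ha, p a, (hf a ha).2.2.2⟩

end FracStable

namespace RSetup
variable {V : Type*} [Fintype V] [DecidableEq V] {S : RSetup V} {x : Sym2 V → ℝ}

open Classical in
/-- A numerical ranking of the neighbours of `v` representing the preferences of `v`. -/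
noncomputable def rank (S : RSetup V) (v u : V) : ℕ :=
  (Finset.univ.filter fun t => s(v, t) ∈ S.E ∧ S.pref v (some s(v, u)) (some s(v, t))).card

theorem pref_iff_rank_le {v u w : V} (hu : s(v, u) ∈ S.E) (hw : s(v, w) ∈ S.E) :
    S.pref v (some s(v, u)) (some s(v, w)) ↔ S.rank v w ≤ S.rank v u := by
  have hE : ∀ t, s(v, t) ∈ S.E → ∀ e, some s(v, t) = some e → e ∈ S.E ∧ v ∈ e := by
    rintro t ht e he
    cases he
    exact ⟨ht, Sym2.mem_mk_left v t⟩
  constructor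
  · intro h
    refine Finset.card_le_card fun t ht => ?_
    simp only [Finset.mem_filter, Finset.mem_univ, true_and] at ht ⊢
    exact ⟨ht.1, S.pref_trans v _ _ _ (hE u hu) (hE w hw) (hE t ht.1) h ht.2⟩
  · intro h
    by_contra hn
    have hwu := (S.pref_total v _ _ (hE u hu) (hE w hw)).resolve_left hn
    refine absurd h (not_le.2 (Finset.card_lt_card ?_))
    rw [Finset.ssubset_iff_of_subset]
    · refine ⟨w, ?_, ?_⟩
      · have := S.pref_total v _ _ (hE w hw) (hE w hw)
        simpa [hw] using this
      · simp [hn]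
    · intro t ht
      simp only [Finset.mem_filter, Finset.mem_univ, true_and] at ht ⊢
      exact ⟨ht.1, S.pref_trans v _ _ _ (hE w hw) (hE u hu) (hE t ht.1) hwu ht.2⟩

theorem sPref_iff_rank_lt {v u w : V} (hu : s(v, u) ∈ S.E) (hw : s(v, w) ∈ S.E) :
    S.SPref v (some s(v, u)) (some s(v, w)) ↔ S.rank v w < S.rank v u := by
  rw [SPref, pref_iff_rank_le hu hw, pref_iff_rank_le hw hu]
  omega

theorem iPref_iff_rank_eq {v u w : V} (hu : s(v, u) ∈ S.E) (hw : s(v, w) ∈ S.E) :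
    S.IPref v (some s(v, u)) (some s(v, w)) ↔ S.rank v u = S.rank v w := by
  rw [IPref, pref_iff_rank_le hu hw, pref_iff_rank_le hw hu]
  omega

theorem xS_inc_filter (hx : ∀ e ∉ S.E, x e = 0) (v : V) (q : Sym2 V → Prop) [DecidablePred q] :
    xS x ((inc S.E v).filter q) = ∑ w, if q s(v, w) then x s(v, w) else 0 := by
  have h1 : (inc S.E v).filter q
      = (Finset.univ.filter fun w => s(v, w) ∈ S.E ∧ q s(v, w)).image fun w => s(v, w) := by
    ext e
    simp only [inc, Finset.mem_filter, Finset.mem_image, Finset.mem_univ, true_and]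
    constructor
    · rintro ⟨⟨he, w, rfl⟩, hq⟩
      exact ⟨w, ⟨he, hq⟩, rfl⟩
    · rintro ⟨w, ⟨he, hq⟩, rfl⟩
      exact ⟨⟨he, Sym2.mem_mk_left v w⟩, hq⟩
  rw [xS, h1, Finset.sum_image fun a _ b _ h => Sym2.congr_right.1 h, Finset.sum_filter]
  refine Finset.sum_congr rfl fun w _ => ?_
  by_cases hE : s(v, w) ∈ S.E
  · simp [hE]
  · simp [hx _ hE]

theorem xS_inc (hx : ∀ e ∉ S.E, x e = 0) (v : V) : xS x (inc S.E v) = ∑ w, x s(v, w) := by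
  simpa using xS_inc_filter hx v fun _ => True

theorem xS_succSet (hx : ∀ e ∉ S.E, x e = 0) {v w : V} (hw : s(v, w) ∈ S.E) :
    xS x (S.succSet v s(v, w)) = strictUp S.rank (fun a b => x s(a, b)) v w := by
  classical
  rw [succSet, xS_inc_filter hx, strictUp]
  refine Finset.sum_congr rfl fun u _ => ?_
  by_cases hE : s(v, u) ∈ S.E
  · simp only [sPref_iff_rank_lt hE hw]
  · simp [hx _ hE]

theorem xS_simSet_add_xS_succSet (hx : ∀ e ∉ S.E, x e = 0) {v w : V} (hw : s(v, w) ∈ S.E) :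
    xS x (S.simSet v s(v, w)) + xS x (S.succSet v s(v, w))
      = weakUp S.rank (fun a b => x s(a, b)) v w := by
  classical
  rw [simSet, succSet, xS_inc_filter hx, xS_inc_filter hx, weakUp, ← Finset.sum_add_distrib]
  refine Finset.sum_congr rfl fun u _ => ?_
  by_cases hE : s(v, u) ∈ S.E
  · simp only [sPref_iff_rank_lt hE hw, iPref_iff_rank_eq hE hw]
    split_ifs <;> first | omega | ring
  · simp [hx _ hE]

theorem sum_sum_eq_two_mul_xS_esub (hx : ∀ e ∉ S.E, x e = 0) (X : Finset V) :
    ∑ a ∈ X, ∑ b ∈ X, x s(a, b) = 2 * xS x (S.esub X) := by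
  classical
  let D := (X ×ˢ X).filter fun d => s(d.1, d.2) ∈ S.E
  have h1 : ∑ a ∈ X, ∑ b ∈ X, x s(a, b) = ∑ d ∈ D, x s(d.1, d.2) := by
    rw [← Finset.sum_product', Finset.sum_filter_of_ne]
    intro d _ hd
    by_contra h
    exact hd (hx _ h)
  have h2 : ∀ d ∈ D, s(d.1, d.2) ∈ S.esub X := by
    rintro ⟨a, b⟩ hd
    simp only [D, Finset.mem_filter, Finset.mem_product] at hd
    simp [esub, hd.1.1, hd.1.2, hd.2]
  rw [h1, ← Finset.sum_fiberwise_of_maps_to h2, xS, Finset.mul_sum]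
  refine Finset.sum_congr rfl fun e he => ?_
  induction e with | _ a b
  simp only [esub, Finset.mem_filter, Sym2.mem_iff, forall_eq_or_imp, forall_eq] at he
  have hab : a ≠ b := fun h => S.not_diag _ he.1 (Sym2.mk_isDiag_iff.2 h)
  have h3 : D.filter (fun d => s(d.1, d.2) = s(a, b)) = {(a, b), (b, a)} := by
    ext ⟨c, d⟩
    simp only [D, Finset.mem_filter, Finset.mem_product, Finset.mem_insert, Finset.mem_singleton,
      Prod.mk.injEq, Sym2.eq_iff]
    constructor
    · exact fun h => h.2
    · rintro (⟨rfl, rfl⟩ | ⟨rfl, rfl⟩)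
      · exact ⟨⟨he.2, he.1⟩, Or.inl ⟨rfl, rfl⟩⟩
      · exact ⟨⟨⟨he.2.2, he.2.1⟩, by rw [Sym2.eq_swap]; exact he.1⟩, Or.inr ⟨rfl, rfl⟩⟩
  rw [h3, Finset.sum_pair (by simp [hab]), Sym2.eq_swap (a := b)]
  ring

theorem fracStable_iff_memP (hx : S.IsVec x) :
    FracStable (fun a b => s(a, b) ∈ S.E) S.rank (fun a b => x s(a, b)) ↔ S.memP x := by
  have hC2 : ∀ v w, s(v, w) ∈ S.E → xS x (S.simSet v s(v, w)) +
      (xS x (S.succSet v s(v, w)) + xS x (S.succSet w s(v, w)))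
      = weakUp S.rank (fun a b => x s(a, b)) v w + strictUp S.rank (fun a b => x s(a, b)) w v := by
    intro v w h
    rw [← add_assoc, xS_simSet_add_xS_succSet hx.2 h, Sym2.eq_swap,
      xS_succSet hx.2 (by rwa [Sym2.eq_swap])]
  have hC3 : ∀ X : Finset V, Odd X.card → (xS x (S.esub X) ≤ ((X.card / 2 : ℕ) : ℝ) ↔
      ∑ a ∈ X, ∑ b ∈ X, x s(a, b) ≤ X.card - 1) := by
    intro X hX
    obtain ⟨k, hk⟩ := hX
    rw [sum_sum_eq_two_mul_xS_esub hx.2, hk, show (2 * k + 1) / 2 = k by omega]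
    push_cast
    constructor <;> intro <;> linarith
  constructor
  · intro h
    refine ⟨hx, fun v => ?_, fun v w hvw => ?_, fun X hX => (hC3 X hX).2 (h.odd X hX)⟩
    · rw [xS_inc hx.2]
      exact h.row_le v
    · rw [hC2 v w hvw]
      exact h.cover v w hvw
  · rintro ⟨-, h1, h2, h3⟩
    refine ⟨fun v w => hx.1 _, fun v w => by rw [Sym2.eq_swap], fun v w => hx.2 _, fun v => ?_,
      fun v w hvw => ?_, fun X hX => (hC3 X hX).1 (h3 X hX)⟩
    · rw [← xS_inc hx.2]
      exact h1 v
    · rw [← hC2 v w hvw]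
      exact h2 v w hvw

theorem matchOf_eq_some {μ : Finset (Sym2 V)} {v : V} {e : Sym2 V} (h : matchOf μ v = some e) :
    e ∈ μ ∧ v ∈ e := by
  have := Finset.mem_toList.1 (List.mem_of_mem_head? h)
  simpa [inc] using this

open Classical in
theorem StronglyStable.fracStable_chi {μ : Finset (Sym2 V)} (hμ : S.StronglyStable μ) :
    FracStable (fun a b => s(a, b) ∈ S.E) S.rank (fun a b => chi μ s(a, b)) := by
  have nonneg : ∀ e, 0 ≤ chi μ e := fun e => by
    rw [chi]
    split_ifs <;> simp
  have supp : ∀ e ∉ S.E, chi μ e = 0 := fun e he => if_neg fun h => he (hμ.1.1 h)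
  have symm : ∀ a b : V, chi μ s(a, b) = chi μ s(b, a) := fun a b => by rw [Sym2.eq_swap]
  have row_le : ∀ v : V, ∑ w, chi μ s(v, w) ≤ 1 := by
    intro v
    rw [← xS_inc supp, xS]
    simp only [chi]
    rw [← Finset.sum_filter, Finset.sum_const, nsmul_eq_mul, mul_one]
    have h1 : (inc S.E v).filter (· ∈ μ) ⊆ inc μ v := by
      intro e
      simp only [inc, Finset.mem_filter]
      tauto
    exact_mod_cast (Finset.card_le_card h1).trans (hμ.1.2 v)
  refine ⟨fun v w => nonneg _, symm, fun v w => supp _, row_le, fun v w hvw => ?_,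
    sum_sum_le_of_zero_one _ symm (fun a => supp _ fun h => S.not_diag _ h (by simp)) row_le
      fun a b => ?_⟩
  · have one_le_weakUp : ∀ u, s(v, u) ∈ μ → S.rank v w ≤ S.rank v u →
        1 ≤ weakUp S.rank (fun a b => chi μ s(a, b)) v w := by
      intro u hu h
      refine le_trans ?_ (Finset.single_le_sum (fun t _ => ?_) (Finset.mem_univ u))
      · simp [h, chi, hu]
      · split_ifs
        exacts [nonneg _, le_rfl]
    have one_le_strictUp : ∀ u, s(w, u) ∈ μ → S.rank w v < S.rank w u →
        1 ≤ strictUp S.rank (fun a b => chi μ s(a, b)) w v := by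
      intro u hu h
      refine le_trans ?_ (Finset.single_le_sum (fun t _ => ?_) (Finset.mem_univ u))
      · simp [h, chi, hu]
      · split_ifs
        exacts [nonneg _, le_rfl]
    have hw0 : 0 ≤ weakUp S.rank (fun a b => chi μ s(a, b)) v w :=
      Finset.sum_nonneg fun u _ => by
        split_ifs
        exacts [nonneg _, le_rfl]
    have hs0 : 0 ≤ strictUp S.rank (fun a b => chi μ s(a, b)) w v :=
      Finset.sum_nonneg fun u _ => by
        split_ifs
        exacts [nonneg _, le_rfl]
    have hwv : s(w, v) ∈ S.E := by rwa [Sym2.eq_swap]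
    by_cases hmem : s(v, w) ∈ μ
    · linarith [one_le_weakUp w hmem le_rfl]
    have hpartner : ∀ a b, s(a, b) ∈ S.E → ¬ S.SPref a (some s(a, b)) (matchOf μ a) →
        ∃ u, matchOf μ a = some s(a, u) ∧ s(a, u) ∈ μ := by
      intro a b hab h
      cases hm : matchOf μ a with
      | none => exact absurd (hm ▸ S.pref_none a _ hab (Sym2.mem_mk_left a b)) h
      | some e =>
        obtain ⟨he, u, rfl⟩ := matchOf_eq_some hm
        exact ⟨u, rfl, he⟩
    have hnb := hμ.2 s(v, w)
    by_cases hv : S.SPref v (some s(v, w)) (matchOf μ v)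
    · have hw : ¬ S.pref w (some s(w, v)) (matchOf μ w) := by
        intro hw
        refine hnb ⟨hvw, hmem, ?_, v, Sym2.mem_mk_left v w, hv⟩
        simp only [Sym2.mem_iff, forall_eq_or_imp, forall_eq]
        exact ⟨hv.1, by rwa [Sym2.eq_swap]⟩
      obtain ⟨u, hu, huμ⟩ := hpartner w v hwv fun h => hw h.1
      rw [hu, pref_iff_rank_le hwv (hμ.1.1 huμ)] at hw
      linarith [one_le_strictUp u huμ (not_le.1 hw)]
    · obtain ⟨u, hu, huμ⟩ := hpartner v w hvw hv
      rw [hu, sPref_iff_rank_lt hvw (hμ.1.1 huμ)] at hv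
      linarith [one_le_weakUp u huμ (not_lt.1 hv)]
  · simp only [chi]
    split_ifs <;> simp

theorem mem_inc_supp {v u : V} : s(v, u) ∈ inc (S.supp x) v ↔ s(v, u) ∈ S.E ∧ 0 < x s(v, u) := by
  simp [inc, supp]

theorem exists_of_mem_inc_supp {v : V} {e : Sym2 V} (h : e ∈ inc (S.supp x) v) :
    ∃ u, e = s(v, u) ∧ s(v, u) ∈ S.E ∧ 0 < x s(v, u) := by
  obtain ⟨u, rfl⟩ := (Finset.mem_filter.1 h).2
  exact ⟨u, rfl, mem_inc_supp.1 h⟩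

theorem mem_Tset_of_median (hx : S.memP x) {a b c d : V} (hab : s(a, b) ∈ S.E)
    (ha : ∑ u, x s(a, u) = 1) (hb : ∑ u, x s(b, u) = 1)
    (hma : FracStable.Median S.rank (fun a b => x s(a, b)) a b c)
    (hmb : FracStable.Median S.rank (fun a b => x s(a, b)) b a d) :
    s(a, b) ∈ S.Tset x := by
  classical
  have hsupp : ∀ {v u}, 0 < x s(v, u) → s(v, u) ∈ S.E := by
    intro v u h
    by_contra hn
    exact h.ne' (hx.1.2 _ hn)
  have hV1 : ∀ v, ∑ u, x s(v, u) = 1 → v ∈ S.V1 := fun v hv =>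
    ⟨x, hx, by rw [xS_inc hx.1.2, hv]; exact one_pos⟩
  have key : ∀ v w c, s(v, w) ∈ S.E →
      FracStable.Median S.rank (fun a b => x s(a, b)) v w c →
      s(v, w) ∈ S.Bset x v ∪ S.Wset x v ∨
        ((∀ f ∈ S.Bset x v, S.SPref v (some f) (some s(v, w))) ∧
          (∀ f ∈ S.Wset x v, S.SPref v (some s(v, w)) (some f))) := by
    rintro v w c hvw ⟨-, -, ⟨h0, h⟩ | ⟨⟨u, hu, hr⟩, t, ht, hr'⟩⟩
    · left
      rw [Finset.mem_union]
      refine h.imp (fun h => ?_) fun h => ?_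
      · refine Finset.mem_filter.2 ⟨mem_inc_supp.2 ⟨hvw, h0⟩, fun f hf => ?_⟩
        obtain ⟨u, rfl, huE, hu⟩ := exists_of_mem_inc_supp hf
        exact (pref_iff_rank_le hvw huE).2 (h u hu)
      · refine Finset.mem_filter.2 ⟨mem_inc_supp.2 ⟨hvw, h0⟩, fun f hf => ?_⟩
        obtain ⟨u, rfl, huE, hu⟩ := exists_of_mem_inc_supp hf
        exact (pref_iff_rank_le huE hvw).2 (h u hu)
    · right
      constructor
      · intro f hf
        obtain ⟨hf, hbest⟩ := Finset.mem_filter.1 hf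
        obtain ⟨q, rfl, hqE, -⟩ := exists_of_mem_inc_supp hf
        have := hbest _ (mem_inc_supp.2 ⟨hsupp hu, hu⟩)
        rw [pref_iff_rank_le hqE (hsupp hu)] at this
        exact (sPref_iff_rank_lt hqE hvw).2 (hr.trans_le this)
      · intro f hf
        obtain ⟨hf, hworst⟩ := Finset.mem_filter.1 hf
        obtain ⟨q, rfl, hqE, -⟩ := exists_of_mem_inc_supp hf
        have := hworst _ (mem_inc_supp.2 ⟨hsupp ht, ht⟩)
        rw [pref_iff_rank_le (hsupp ht) hqE] at this
        exact (sPref_iff_rank_lt hvw hqE).2 (this.trans_lt hr')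
  rw [Tset]
  simp only [Finset.mem_filter, Sym2.mem_iff, forall_eq_or_imp, forall_eq]
  refine ⟨⟨hab, hV1 a ha, hV1 b hb⟩, key a b c hab hma, ?_⟩
  have := key b a d (by rwa [Sym2.eq_swap]) hmb
  rwa [Sym2.eq_swap] at this

end RSetup

open RSetup in
/-- if there exist `x ∈ P` and an edge `g ∈ E` such that every
`y ∈ P(T_x)` satisfies `0 < y(g) < 1`, then there is no strongly stable
matching in `G`. -/
theorem no_stronglyStable_of_fractional
    {V : Type*} [Fintype V] [DecidableEq V] (S : RSetup V)
    (hP : ∃ y : Sym2 V → ℝ, S.memP y)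
    (h : ∃ (x : Sym2 V → ℝ) (g : Sym2 V), S.memP x ∧ g ∈ S.E ∧
      ∀ y : Sym2 V → ℝ, S.memPF (S.Tset x) y → 0 < y g ∧ y g < 1) :
    ¬ ∃ μ : Finset (Sym2 V), S.StronglyStable μ := by
  rintro ⟨μ, hμ⟩
  obtain ⟨x, g, hx, hg, hy⟩ := h
  have hA : ∀ a, ¬ s(a, a) ∈ S.E := fun a h => S.not_diag _ h (by simp)
  have hchi : ∀ a b, chi μ s(a, b) = 0 ∨ chi μ s(a, b) = 1 := fun a b => by
    simp only [chi]
    split_ifs <;> simp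
  obtain ⟨y, hyS, h01, hmed⟩ := FracStable.exists_integral hA
    ((fracStable_iff_memP hx.1).2 hx) hμ.fracStable_chi hchi
  let Y : Sym2 V → ℝ := Sym2.lift ⟨y, hyS.symm⟩
  have hYP : S.memP Y := by
    refine (fracStable_iff_memP ⟨fun e => ?_, fun e he => ?_⟩).1 hyS
    · induction e with | _ a b
      exact hyS.nonneg a b
    · induction e with | _ a b
      exact hyS.supp a b he
  have hYT : S.memPF (S.Tset x) Y := by
    refine ⟨hYP, fun e he heT => ?_⟩
    induction e with | _ a b
    by_contra hne
    obtain ⟨ha, c, hma⟩ := hmed a b hne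
    obtain ⟨hb, d, hmb⟩ := hmed b a (by rw [hyS.symm]; exact hne)
    exact heT (mem_Tset_of_median hx he ha hb hma hmb)
  have h1 := hy Y hYT
  induction g with | _ a b
  rcases h01 a b with h | h
  · exact h1.1.ne' h
  · exact h1.2.ne h
end
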